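/- Assume hypotheses (H1)–(H3), let q0, q be chosen with 1 − 1/p < 1/q0 < min{β, δα, δ/p, 1/2} and 1/(q0·δ) ≤ 1/q < min{α, 1/p}, let ω : [0,T] → ℝ^m be continuous of finite p-variation, let [t0,t1] ⊆ [0,T], and define F(x)_t := x_{t0} + ∫_{t0}^t f(s,x_s) ds + ∫_{t0}^t g(s,x_s) dω_s. Let N ≥ 0 and let x, y : [t0,t1] → ℝ^d be continuous of finite q-variation with ‖x‖_{∞,[t0,t1]} ≤ N, ‖y‖_{∞,[t0,t1]} ≤ N and x_{t0} = y_{t0}. Then ‖F(x) − F(y)‖_{q-var,[t0,t1]} ≤ ‖x − y‖_{q-var,[t0,t1]} · ( (t1 − t0) + |||ω|||_{p-var,[t0,t1]} ) · M'_N (K+1) · ( 2 + |||x|||^δ_{q-var,[t0,t1]} + |||y|||^δ_{q-var,[t0,t1]} ), where K := (1 − 2^{1−θ})^{−1} with θ := 1/p + 1/q0, M := max{L_g, a·T^{1−α}, |g(0,0)| + h(0,T)^β, ‖b‖_{L_{1/(1−α)}}}, and M'_N := max{L_N, M_N, M}. -/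

import Mathlib

open scoped BigOperators
open Set

noncomputable section

/-- Euclidean space `ℝ^n`. -/
abbrev Ed (n : ℕ) : Type := EuclideanSpace ℝ (Fin n)

section PVarDefs

variable {E F : Type*} [NormedAddCommGroup E] [NormedSpace ℝ E]
  [NormedAddCommGroup F] [NormedSpace ℝ F]

/-- The set of sums `Σ_i ‖x (t (i+1)) - x (t i)‖ ^ p` over all finite partitions
`a = t 0 < t 1 < ⋯ < t n = b` of `[a,b]`. -/
def pVarSums (p : ℝ) (x : ℝ → E) (a b : ℝ) : Set ℝ :=
  { v | ∃ n : ℕ, ∃ t : Fin (n + 1) → ℝ, StrictMono t ∧ t 0 = a ∧ t (Fin.last n) = b ∧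
      v = ∑ i : Fin n, ‖x (t i.succ) - x (t i.castSucc)‖ ^ p }

/-- The `p`-variation seminorm `|||x|||_{p-var,[a,b]}`. -/
def pVar (p : ℝ) (x : ℝ → E) (a b : ℝ) : ℝ :=
  sSup (pVarSums p x a b) ^ (1 / p)

/-- `x` is of finite `p`-variation on `[a,b]`. -/
def FinitePVar (p : ℝ) (x : ℝ → E) (a b : ℝ) : Prop :=
  BddAbove (pVarSums p x a b)

/-- The `p`-variation norm `‖x‖_{p-var,[a,b]} = ‖x a‖ + |||x|||_{p-var,[a,b]}`. -/
def pVarNorm (p : ℝ) (x : ℝ → E) (a b : ℝ) : ℝ :=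
  ‖x a‖ + pVar p x a b

/-- A control function on `[a,b]`: continuous on the simplex, vanishing on the diagonal,
superadditive and nonnegative. -/
def IsControlOn (a b : ℝ) (w : ℝ → ℝ → ℝ) : Prop :=
  ContinuousOn (fun pr : ℝ × ℝ => w pr.1 pr.2) {pr : ℝ × ℝ | a ≤ pr.1 ∧ pr.1 ≤ pr.2 ∧ pr.2 ≤ b} ∧
  (∀ t : ℝ, a ≤ t → t ≤ b → w t t = 0) ∧
  (∀ s t u : ℝ, a ≤ s → s ≤ t → t ≤ u → u ≤ b → w s t + w t u ≤ w s u) ∧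
  (∀ s t : ℝ, a ≤ s → s ≤ t → t ≤ b → 0 ≤ w s t)

/-- A tagged partition `a = t 0 < t 1 < ⋯ < t n = b` of `[a,b]`, with tags
`tag i ∈ [t i, t (i+1)]`. -/
structure TaggedPartition (a b : ℝ) where
  n : ℕ
  t : Fin (n + 1) → ℝ
  tag : Fin n → ℝ
  mono : StrictMono t
  first : t 0 = a
  last : t (Fin.last n) = b
  tag_mem : ∀ i : Fin n, tag i ∈ Set.Icc (t i.castSucc) (t i.succ)

/-- The mesh of a tagged partition. -/
def TaggedPartition.mesh {a b : ℝ} (P : TaggedPartition a b) : ℝ :=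
  ⨆ i : Fin P.n, (P.t i.succ - P.t i.castSucc)

/-- Riemann–Stieltjes sum of `x` against `ω` along a tagged partition. -/
def RSSum (x : ℝ → E →L[ℝ] F) (ω : ℝ → E) {a b : ℝ} (P : TaggedPartition a b) : F :=
  ∑ i : Fin P.n, x (P.tag i) (ω (P.t i.succ) - ω (P.t i.castSucc))

/-- `v` is the Young integral `∫_a^b x dω`: the Riemann–Stieltjes sums converge to `v`
as the mesh tends to `0`. -/
def IsYoungIntegral (x : ℝ → E →L[ℝ] F) (ω : ℝ → E) (a b : ℝ) (v : F) : Prop :=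
  ∀ ε : ℝ, 0 < ε → ∃ δ : ℝ, 0 < δ ∧
    ∀ P : TaggedPartition a b, P.mesh < δ → ‖RSSum x ω P - v‖ < ε

/-- The Young integral `∫_a^b x dω` (an arbitrary value, `0`, if the limit does not exist). -/
def youngIntegral (x : ℝ → E →L[ℝ] F) (ω : ℝ → E) (a b : ℝ) : F :=
  letI := Classical.propDecidable (∃ v, IsYoungIntegral x ω a b v)
  if hv : ∃ v, IsYoungIntegral x ω a b v then hv.choose else 0

end PVarDefs

/-- The map `F(x)_t = x t0 + ∫_{t0}^t f(s, x s) ds + ∫_{t0}^t g(s, x s) dω_s`. -/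
def Fmap {d m : ℕ} (f : ℝ → Ed d → Ed d) (g : ℝ → Ed d → (Ed m →L[ℝ] Ed d))
    (ω : ℝ → Ed m) (t0 : ℝ) (x : ℝ → Ed d) : ℝ → Ed d :=
  fun t => x t0 + (∫ s in t0..t, f s (x s)) + youngIntegral (fun s => g s (x s)) ω t0 t


section PVarLemmas

variable {E : Type*} [NormedAddCommGroup E]

/-- The sums of `‖x (u (i+1)) - x (u i)‖ ^ r` along monotone sequences `u` in `[s,t]` are at
most `V`. -/
def MonoVarLE (r : ℝ) (x : ℝ → E) (s t V : ℝ) : Prop :=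
  ∀ (n : ℕ) (u : ℕ → ℝ), Monotone u → (∀ i, u i ∈ Icc s t) →
    ∑ i ∈ Finset.range n, ‖x (u (i + 1)) - x (u i)‖ ^ r ≤ V

/-- Extension of a finite sequence to `ℕ`, constant after its last term. -/
def seqOfFin {n : ℕ} (t : Fin (n + 1) → ℝ) (i : ℕ) : ℝ :=
  t ⟨min i n, Nat.lt_succ_of_le (min_le_right i n)⟩

lemma seqOfFin_castSucc {n : ℕ} (t : Fin (n + 1) → ℝ) (i : Fin n) :
    seqOfFin t i = t i.castSucc := by
  unfold seqOfFin
  congr 1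
  ext
  simp [i.2.le]

lemma seqOfFin_succ {n : ℕ} (t : Fin (n + 1) → ℝ) (i : Fin n) :
    seqOfFin t (i + 1) = t i.succ := by
  unfold seqOfFin
  congr 1
  ext
  simp [Nat.succ_le_of_lt i.2]

lemma seqOfFin_zero {n : ℕ} (t : Fin (n + 1) → ℝ) : seqOfFin t 0 = t 0 := by
  unfold seqOfFin
  congr 1

lemma seqOfFin_last {n : ℕ} (t : Fin (n + 1) → ℝ) : seqOfFin t n = t (Fin.last n) := by
  unfold seqOfFin
  congr 1
  ext
  simp

lemma monotone_seqOfFin {n : ℕ} {t : Fin (n + 1) → ℝ} (ht : Monotone t) :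
    Monotone (seqOfFin t) := by
  intro i j hij
  apply ht
  rw [Fin.mk_le_mk]
  omega

lemma seqOfFin_mem_Icc {n : ℕ} {t : Fin (n + 1) → ℝ} (ht : Monotone t) (i : ℕ) :
    seqOfFin t i ∈ Icc (t 0) (t (Fin.last n)) :=
  ⟨ht (Fin.zero_le _), ht (Fin.le_last _)⟩

lemma sum_fin_eq_sum_range_seqOfFin {M : Type*} [AddCommMonoid M] {n : ℕ}
    (t : Fin (n + 1) → ℝ) (φ : ℝ → ℝ → M) :
    ∑ i : Fin n, φ (t i.castSucc) (t i.succ) =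
      ∑ i ∈ Finset.range n, φ (seqOfFin t i) (seqOfFin t (i + 1)) := by
  rw [Finset.sum_range]
  exact Finset.sum_congr rfl fun i _ => by rw [seqOfFin_castSucc, seqOfFin_succ]

lemma exists_seq_of_mem_pVarSums {r a b v : ℝ} {x : ℝ → E} (hv : v ∈ pVarSums r x a b) :
    ∃ (n : ℕ) (u : ℕ → ℝ), Monotone u ∧ (∀ i, u i ∈ Icc a b) ∧
      v = ∑ i ∈ Finset.range n, ‖x (u (i + 1)) - x (u i)‖ ^ r := by
  obtain ⟨n, t, ht, rfl, rfl, rfl⟩ := hv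
  exact ⟨n, seqOfFin t, monotone_seqOfFin ht.monotone, seqOfFin_mem_Icc ht.monotone,
    sum_fin_eq_sum_range_seqOfFin t fun c d => ‖x d - x c‖ ^ r⟩

lemma zero_mem_pVarSums_self (r : ℝ) (x : ℝ → E) (a : ℝ) : 0 ∈ pVarSums r x a a :=
  ⟨0, fun _ => a, fun i j hij => by omega, rfl, rfl, by simp⟩

lemma add_mem_pVarSums_of_lt {r a b c v : ℝ} {x : ℝ → E} (hv : v ∈ pVarSums r x a b)
    (hbc : b < c) : v + ‖x c - x b‖ ^ r ∈ pVarSums r x a c := by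
  obtain ⟨n, t, ht, h0, hl, rfl⟩ := hv
  refine ⟨n + 1, Fin.snoc (α := fun _ => ℝ) t c, ?_, ?_, ?_, ?_⟩
  · rw [Fin.strictMono_iff_lt_succ]
    intro i
    refine Fin.lastCases ?_ (fun j => ?_) i
    · rw [Fin.succ_last, Fin.snoc_last, Fin.snoc_castSucc, hl]
      exact hbc
    · rw [Fin.succ_castSucc, Fin.snoc_castSucc, Fin.snoc_castSucc]
      exact ht j.castSucc_lt_succ
  · rw [← Fin.castSucc_zero, Fin.snoc_castSucc, h0]
  · rw [Fin.snoc_last]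
  · rw [Fin.sum_univ_castSucc, Fin.succ_last, Fin.snoc_last, Fin.snoc_castSucc, hl]
    congr 1
    refine Finset.sum_congr rfl fun j _ => ?_
    rw [Fin.succ_castSucc, Fin.snoc_castSucc, Fin.snoc_castSucc]

lemma add_mem_pVarSums_of_le {r a b c v : ℝ} (hr : 0 < r) {x : ℝ → E}
    (hv : v ∈ pVarSums r x a b) (hbc : b ≤ c) : v + ‖x c - x b‖ ^ r ∈ pVarSums r x a c := by
  rcases hbc.eq_or_lt with rfl | h
  · simpa [Real.zero_rpow hr.ne'] using hv
  · exact add_mem_pVarSums_of_lt hv h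

lemma sum_range_mem_pVarSums {r a b v : ℝ} (hr : 0 < r) {x : ℝ → E} {u : ℕ → ℝ}
    (hu : Monotone u) (h0 : u 0 = b) (hv : v ∈ pVarSums r x a b) (n : ℕ) :
    v + ∑ i ∈ Finset.range n, ‖x (u (i + 1)) - x (u i)‖ ^ r ∈ pVarSums r x a (u n) := by
  induction n with
  | zero => simpa [h0] using hv
  | succ n ih =>
    rw [Finset.sum_range_succ, ← add_assoc]
    exact add_mem_pVarSums_of_le hr ih (hu n.le_succ)

lemma FinitePVar.monoVarLE {r s t : ℝ} (hr : 0 < r) {x : ℝ → E} (hx : FinitePVar r x s t) :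
    MonoVarLE r x s t (sSup (pVarSums r x s t)) := by
  intro n u hu hmem
  have h1 : ‖x (u 0) - x s‖ ^ r ∈ pVarSums r x s (u 0) := by
    simpa using add_mem_pVarSums_of_le hr (zero_mem_pVarSums_self r x s) (hmem 0).1
  have h2 := sum_range_mem_pVarSums hr hu rfl h1 n
  refine le_trans ?_ (le_csSup hx (add_mem_pVarSums_of_le hr h2 (hmem n).2))
  have := Real.rpow_nonneg (norm_nonneg (x (u 0) - x s)) r
  have := Real.rpow_nonneg (norm_nonneg (x t - x (u n))) r
  linarith

lemma pVarSums_nonempty {s t : ℝ} (hst : s ≤ t) {r : ℝ} (hr : 0 < r) (x : ℝ → E) :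
    (pVarSums r x s t).Nonempty :=
  ⟨_, add_mem_pVarSums_of_le hr (zero_mem_pVarSums_self r x s) hst⟩

lemma MonoVarLE.finitePVar {r s t V : ℝ} {x : ℝ → E} (hx : MonoVarLE r x s t V) :
    FinitePVar r x s t := by
  refine ⟨V, fun v hv => ?_⟩
  obtain ⟨n, u, hu, hmem, rfl⟩ := exists_seq_of_mem_pVarSums hv
  exact hx n u hu hmem

lemma MonoVarLE.mono {r s t s' t' V V' : ℝ} {x : ℝ → E} (hx : MonoVarLE r x s t V)
    (hs : s ≤ s') (ht : t' ≤ t) (hV : V ≤ V') : MonoVarLE r x s' t' V' := fun n u hu hmem =>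
  (hx n u hu fun i => ⟨hs.trans (hmem i).1, (hmem i).2.trans ht⟩).trans hV

lemma FinitePVar.mono {r s t s' t' : ℝ} (hr : 0 < r) {x : ℝ → E} (hx : FinitePVar r x s t)
    (hs : s ≤ s') (ht : t' ≤ t) : FinitePVar r x s' t' :=
  ((hx.monoVarLE hr).mono hs ht le_rfl).finitePVar

lemma sSup_pVarSums_nonneg (r s t : ℝ) (x : ℝ → E) : 0 ≤ sSup (pVarSums r x s t) := by
  refine Real.sSup_nonneg fun v hv => ?_
  obtain ⟨n, t, -, -, -, rfl⟩ := hv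
  positivity

lemma sSup_pVarSums_le {r s t V : ℝ} (hst : s ≤ t) (hr : 0 < r) {x : ℝ → E}
    (hx : MonoVarLE r x s t V) : sSup (pVarSums r x s t) ≤ V := by
  refine csSup_le (pVarSums_nonempty hst hr x) fun v hv => ?_
  obtain ⟨n, u, hu, hmem, rfl⟩ := exists_seq_of_mem_pVarSums hv
  exact hx n u hu hmem

lemma pVar_nonneg (r s t : ℝ) (x : ℝ → E) : 0 ≤ pVar r x s t :=
  Real.rpow_nonneg (sSup_pVarSums_nonneg r s t x) _

lemma pVar_rpow {r : ℝ} (hr : 0 < r) (s t : ℝ) (x : ℝ → E) :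
    pVar r x s t ^ r = sSup (pVarSums r x s t) := by
  rw [pVar, ← Real.rpow_mul (sSup_pVarSums_nonneg r s t x), one_div_mul_cancel hr.ne',
    Real.rpow_one]

lemma pVar_le_of_monoVarLE {r s t C : ℝ} (hst : s ≤ t) (hr : 0 < r) (hC : 0 ≤ C) {x : ℝ → E}
    (hx : MonoVarLE r x s t (C ^ r)) : pVar r x s t ≤ C := by
  rw [← Real.rpow_le_rpow_iff (pVar_nonneg r s t x) hC hr, pVar_rpow hr]
  exact sSup_pVarSums_le hst hr hx

lemma add_mem_pVarSums {r a b c v w : ℝ} (hr : 0 < r) {x : ℝ → E}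
    (hv : v ∈ pVarSums r x a b) (hw : w ∈ pVarSums r x b c) : v + w ∈ pVarSums r x a c := by
  obtain ⟨n, t, ht, h0, hl, rfl⟩ := hw
  rw [sum_fin_eq_sum_range_seqOfFin t fun c d => ‖x d - x c‖ ^ r, ← hl, ← seqOfFin_last t]
  exact sum_range_mem_pVarSums hr (monotone_seqOfFin ht.monotone)
    ((seqOfFin_zero t).trans h0) hv n

lemma sSup_pVarSums_add_le {r a b s t u : ℝ} (hr : 0 < r) {x : ℝ → E}
    (hx : FinitePVar r x a b) (has : a ≤ s) (hst : s ≤ t) (htu : t ≤ u) (hub : u ≤ b) :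
    sSup (pVarSums r x s t) + sSup (pVarSums r x t u) ≤ sSup (pVarSums r x s u) := by
  rw [← le_sub_iff_add_le]
  refine csSup_le (pVarSums_nonempty hst hr x) fun v hv => ?_
  rw [le_sub_comm]
  refine csSup_le (pVarSums_nonempty htu hr x) fun w hw => ?_
  rw [le_sub_iff_add_le']
  exact le_csSup (hx.mono hr has hub) (add_mem_pVarSums hr hv hw)

lemma MonoVarLE.nonneg {r s t V : ℝ} (hst : s ≤ t) {x : ℝ → E} (hx : MonoVarLE r x s t V) :
    0 ≤ V := by
  simpa using hx 0 (fun _ => s) monotone_const (fun _ => ⟨le_rfl, hst⟩)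

lemma MonoVarLE.norm_rpow_le {r s t V c d : ℝ} {x : ℝ → E} (hx : MonoVarLE r x s t V)
    (hc : s ≤ c) (hcd : c ≤ d) (hd : d ≤ t) : ‖x d - x c‖ ^ r ≤ V := by
  have := hx 1 (fun i => if i = 0 then c else d)
    (monotone_nat_of_le_succ fun n => by rcases n with _ | n <;> simp [hcd])
    (fun i => by rcases i with _ | i <;> constructor <;> simp <;> linarith)
  simpa using this

lemma MonoVarLE.norm_le {r s t V c d : ℝ} (hr : 0 < r) {x : ℝ → E} (hx : MonoVarLE r x s t V)
    (hc : s ≤ c) (hcd : c ≤ d) (hd : d ≤ t) : ‖x d - x c‖ ≤ V ^ (1 / r) := by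
  have h := Real.rpow_le_rpow (by positivity) (hx.norm_rpow_le hc hcd hd)
    (by positivity : 0 ≤ 1 / r)
  rwa [← Real.rpow_mul (norm_nonneg _), mul_one_div_cancel hr.ne', Real.rpow_one] at h

lemma MonoVarLE.of_osc_le {k : ℝ → E} {r r' c d η V : ℝ} (hr : 0 < r) (hrr' : r ≤ r')
    (hη : ∀ s ∈ Icc c d, ∀ t ∈ Icc c d, ‖k t - k s‖ ≤ η)
    (hk : MonoVarLE r k c d V) : MonoVarLE r' k c d (η ^ (r' - r) * V) := by
  intro n u hu hmem
  have hη0 : 0 ≤ η := (norm_nonneg _).trans (hη _ (hmem 0) _ (hmem 0))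
  refine le_trans ?_ (mul_le_mul_of_nonneg_left (hk n u hu hmem) (Real.rpow_nonneg hη0 _))
  rw [Finset.mul_sum]
  refine Finset.sum_le_sum fun i _ => ?_
  have e : ‖k (u (i + 1)) - k (u i)‖ ^ r' =
      ‖k (u (i + 1)) - k (u i)‖ ^ (r' - r) * ‖k (u (i + 1)) - k (u i)‖ ^ r := by
    rw [← Real.rpow_add_of_nonneg (norm_nonneg _) (by linarith) hr.le, sub_add_cancel]
  rw [e]
  exact mul_le_mul_of_nonneg_right (Real.rpow_le_rpow (norm_nonneg _)
    (hη _ (hmem _) _ (hmem _)) (by linarith)) (by positivity)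

lemma sum_rpow_le_rpow_sum {ι : Type*} (S : Finset ι) {c : ι → ℝ} (hc : ∀ i, 0 ≤ c i) {ρ : ℝ}
    (hρ : 1 ≤ ρ) : ∑ i ∈ S, c i ^ ρ ≤ (∑ i ∈ S, c i) ^ ρ := by
  classical
  induction S using Finset.induction_on with
  | empty => simp [Real.zero_rpow (by linarith : ρ ≠ 0)]
  | insert i S hi ih =>
    rw [Finset.sum_insert hi, Finset.sum_insert hi]
    have := Real.add_rpow_le_rpow_add (hc i) (Finset.sum_nonneg fun j (_ : j ∈ S) => hc j) hρ
    linarith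

lemma sum_rpow_le_of_sum_rpow_le {ι : Type*} (S : Finset ι) {c : ι → ℝ} (hc : ∀ i, 0 ≤ c i)
    {r r' C : ℝ} (hr : 0 < r) (hrr' : r ≤ r') (hC : 0 ≤ C) (h : ∑ i ∈ S, c i ^ r ≤ C ^ r) :
    ∑ i ∈ S, c i ^ r' ≤ C ^ r' := by
  have e : ∀ z : ℝ, 0 ≤ z → z ^ r' = (z ^ r) ^ (r' / r) := fun z hz => by
    rw [← Real.rpow_mul hz, mul_div_cancel₀ _ hr.ne']
  rw [Finset.sum_congr rfl fun i _ => e (c i) (hc i), e C hC]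
  refine (sum_rpow_le_rpow_sum S (fun i => Real.rpow_nonneg (hc i) _)
    ((one_le_div hr).2 hrr')).trans ?_
  exact Real.rpow_le_rpow (Finset.sum_nonneg fun i _ => Real.rpow_nonneg (hc i) _) h
    (div_nonneg (hr.le.trans hrr') hr.le)

/-- Minkowski's inequality for sums of `r`-th powers. -/
lemma sum_rpow_le_of_le_add {ι : Type*} (S : Finset ι) {φ c d : ι → ℝ} {r C D : ℝ} (hr : 1 ≤ r)
    (hφ : ∀ i ∈ S, 0 ≤ φ i) (hc : ∀ i ∈ S, 0 ≤ c i) (hd : ∀ i ∈ S, 0 ≤ d i)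
    (hC0 : 0 ≤ C) (hD0 : 0 ≤ D)
    (hle : ∀ i ∈ S, φ i ≤ c i + d i) (hC : ∑ i ∈ S, c i ^ r ≤ C ^ r)
    (hD : ∑ i ∈ S, d i ^ r ≤ D ^ r) : ∑ i ∈ S, φ i ^ r ≤ (C + D) ^ r := by
  have hr0 : 0 < r := by linarith
  have key : ∀ (e : ι → ℝ) (A : ℝ), (∀ i ∈ S, 0 ≤ e i) → 0 ≤ A →
      ∑ i ∈ S, e i ^ r ≤ A ^ r → (∑ i ∈ S, e i ^ r) ^ (1 / r) ≤ A := fun e A he hA h => by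
    have h1 := Real.rpow_le_rpow (Finset.sum_nonneg fun i hi => Real.rpow_nonneg (he i hi) _) h
      (by positivity : 0 ≤ 1 / r)
    rwa [← Real.rpow_mul hA, mul_one_div_cancel hr0.ne', Real.rpow_one] at h1
  have h1 : ∑ i ∈ S, φ i ^ r ≤ ∑ i ∈ S, (c i + d i) ^ r :=
    Finset.sum_le_sum fun i hi => Real.rpow_le_rpow (hφ i hi) (hle i hi) hr0.le
  have h2 := Real.Lp_add_le_of_nonneg S hr hc hd
  have h0 : 0 ≤ ∑ i ∈ S, (c i + d i) ^ r :=
    Finset.sum_nonneg fun i hi => Real.rpow_nonneg (add_nonneg (hc i hi) (hd i hi)) _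
  have h3 : (∑ i ∈ S, (c i + d i) ^ r) ^ (1 / r) ≤ C + D :=
    h2.trans (add_le_add (key c C hc hC0 hC) (key d D hd hD0 hD))
  have h4 := Real.rpow_le_rpow (by positivity) h3 hr0.le
  rw [← Real.rpow_mul h0, one_div_mul_cancel hr0.ne', Real.rpow_one] at h4
  exact h1.trans h4

lemma sum_const_mul_rpow_le {ι : Type*} (S : Finset ι) {c : ι → ℝ} {r C A : ℝ}
    (hA : 0 ≤ A) (hC : 0 ≤ C) (hc : ∀ i ∈ S, 0 ≤ c i) (h : ∑ i ∈ S, c i ^ r ≤ C ^ r) :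
    ∑ i ∈ S, (A * c i) ^ r ≤ (A * C) ^ r := by
  rw [Finset.sum_congr rfl fun i hi => Real.mul_rpow hA (hc i hi), ← Finset.mul_sum,
    Real.mul_rpow hA hC]
  exact mul_le_mul_of_nonneg_left h (Real.rpow_nonneg hA _)

lemma sum_superadditive_le {a b : ℝ} {w : ℝ → ℝ → ℝ}
    (hw : ∀ s t u : ℝ, a ≤ s → s ≤ t → t ≤ u → u ≤ b → w s t + w t u ≤ w s u)
    (hw0 : ∀ s t : ℝ, a ≤ s → s ≤ t → t ≤ b → 0 ≤ w s t) {u : ℕ → ℝ} (hu : Monotone u)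
    (hmem : ∀ i, u i ∈ Icc a b) (n : ℕ) :
    ∑ i ∈ Finset.range n, w (u i) (u (i + 1)) ≤ w a b := by
  have h : ∑ i ∈ Finset.range n, w (u i) (u (i + 1)) ≤ w (u 0) (u n) := by
    induction n with
    | zero => simpa using hw0 _ _ (hmem 0).1 le_rfl (hmem 0).2
    | succ n ih =>
      rw [Finset.sum_range_succ]
      exact (add_le_add_left ih _).trans
        (hw _ _ _ (hmem 0).1 (hu n.zero_le) (hu n.le_succ) (hmem _).2)
  have h1 := hw a (u 0) (u n) le_rfl (hmem 0).1 (hu n.zero_le) (hmem n).2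
  have h2 := hw a (u n) b le_rfl (hmem n).1 (hmem n).2 le_rfl
  have h3 := hw0 a (u 0) le_rfl (hmem 0).1 (hmem 0).2
  have h4 := hw0 (u n) b (hmem n).1 (hmem n).2 le_rfl
  linarith

lemma sum_superadditive_rpow_le {a b : ℝ} {w : ℝ → ℝ → ℝ}
    (hw : ∀ s t u : ℝ, a ≤ s → s ≤ t → t ≤ u → u ≤ b → w s t + w t u ≤ w s u)
    (hw0 : ∀ s t : ℝ, a ≤ s → s ≤ t → t ≤ b → 0 ≤ w s t) {ρ : ℝ} (hρ : 1 ≤ ρ) {u : ℕ → ℝ}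
    (hu : Monotone u) (hmem : ∀ i, u i ∈ Icc a b) (n : ℕ) :
    ∑ i ∈ Finset.range n, w (u i) (u (i + 1)) ^ ρ ≤ w a b ^ ρ := by
  have h0 : ∀ i, 0 ≤ w (u i) (u (i + 1)) := fun i =>
    hw0 _ _ (hmem i).1 (hu i.le_succ) (hmem _).2
  exact (sum_rpow_le_rpow_sum _ h0 hρ).trans (Real.rpow_le_rpow (Finset.sum_nonneg fun i _ => h0 i)
    (sum_superadditive_le hw hw0 hu hmem n) (by linarith))

end PVarLemmas

section YoungLemmas

variable {E F : Type*} [NormedAddCommGroup E] [NormedSpace ℝ E]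
  [NormedAddCommGroup F] [NormedSpace ℝ F]

lemma sum_range_succ_rpow_neg_le {θ : ℝ} (hθ : 1 < θ) (n : ℕ) :
    ∑ j ∈ Finset.range n, ((j : ℝ) + 1) ^ (-θ) ≤ (1 - (2 : ℝ) ^ (1 - θ))⁻¹ := by
  have hlt : (2 : ℝ) ^ (1 - θ) < 1 :=
    Real.rpow_lt_one_of_one_lt_of_neg (by norm_num) (by linarith)
  have hanti : ∀ ⦃m k : ℕ⦄, 0 < m → m ≤ k → ((k : ℝ)) ^ (-θ) ≤ (m : ℝ) ^ (-θ) :=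
    fun m k hm hmk => Real.rpow_le_rpow_of_nonpos (by exact_mod_cast hm) (by exact_mod_cast hmk)
      (by linarith)
  have h1 := Finset.le_sum_condensed (f := fun j : ℕ => (j : ℝ) ^ (-θ)) hanti (n + 1)
  have h2 : ∑ j ∈ Finset.range n, ((j : ℝ) + 1) ^ (-θ) =
      ∑ j ∈ Finset.range (n + 1), (j : ℝ) ^ (-θ) := by
    rw [Finset.sum_range_succ']
    simp [Real.zero_rpow (by linarith : -θ ≠ 0)]
  have h3 : ∑ j ∈ Finset.range (n + 1), (j : ℝ) ^ (-θ) ≤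
      ∑ j ∈ Finset.range (2 ^ (n + 1)), (j : ℝ) ^ (-θ) :=
    Finset.sum_le_sum_of_subset_of_nonneg (Finset.range_mono (Nat.lt_two_pow_self).le)
      fun _ _ _ => by positivity
  have h4 : ∑ k ∈ Finset.range (n + 1), 2 ^ k • (((2 ^ k : ℕ) : ℝ)) ^ (-θ) =
      ∑ k ∈ Finset.range (n + 1), ((2 : ℝ) ^ (1 - θ)) ^ k := by
    refine Finset.sum_congr rfl fun k _ => ?_
    rw [nsmul_eq_mul, ← Real.rpow_natCast ((2 : ℝ) ^ (1 - θ)), ← Real.rpow_mul (by norm_num)]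
    push_cast
    rw [← Real.rpow_natCast 2 k, ← Real.rpow_mul (by norm_num), ← Real.rpow_add (by norm_num)]
    congr 1
    ring
  have h5 : ∑ k ∈ Finset.range (n + 1), ((2 : ℝ) ^ (1 - θ)) ^ k ≤ (1 - (2 : ℝ) ^ (1 - θ))⁻¹ :=
    sum_le_hasSum _ (fun _ _ => by positivity) (hasSum_geometric_of_lt_one (by positivity) hlt)
  rw [h4, Nat.cast_zero, Real.zero_rpow (by linarith : -θ ≠ 0), zero_add] at h1
  rw [h2]
  exact h3.trans (h1.trans h5)

lemma exists_mul_le_rpow {n : ℕ} {c d : ℕ → ℝ} (hc : ∀ i, 0 ≤ c i) (hd : ∀ i, 0 ≤ d i)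
    {r p A B : ℝ} (hr : 0 < r) (hp : 0 < p)
    (hA : ∑ i ∈ Finset.range (n + 1), c i ^ r ≤ A) (hB : ∑ i ∈ Finset.range (n + 1), d i ^ p ≤ B) :
    ∃ i ≤ n, c i * d i ≤ ((n : ℝ) + 1) ^ (-(1 / p + 1 / r)) * (A ^ (1 / r) * B ^ (1 / p)) := by
  set θ := 1 / p + 1 / r with hθ
  have hθ0 : 0 < θ := by positivity
  have hA0 : 0 ≤ A := le_trans (Finset.sum_nonneg fun i _ => Real.rpow_nonneg (hc i) _) hA
  have hB0 : 0 ≤ B := le_trans (Finset.sum_nonneg fun i _ => Real.rpow_nonneg (hd i) _) hB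
  have hconj : (r * θ).HolderConjugate (p * θ) := by
    rw [Real.holderConjugate_iff]
    constructor
    · rw [hθ, mul_add, mul_one_div_cancel hr.ne']
      have : 0 < r * (1 / p) := by positivity
      linarith
    · rw [mul_inv, mul_inv, ← add_mul, hθ, one_div, one_div, add_comm r⁻¹]
      exact mul_inv_cancel₀ (by positivity)
  have hH := Real.inner_le_Lp_mul_Lq_of_nonneg (Finset.range (n + 1)) hconj
    (f := fun i => c i ^ (1 / θ)) (g := fun i => d i ^ (1 / θ))
    (fun i _ => Real.rpow_nonneg (hc i) _) (fun i _ => Real.rpow_nonneg (hd i) _)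
  have e : ∀ (z : ℝ) (m : ℝ), 0 ≤ z → (z ^ (1 / θ)) ^ (m * θ) = z ^ m := fun z m hz => by
    rw [← Real.rpow_mul hz]
    congr 1
    field_simp
  simp only [e _ _ (hc _), e _ _ (hd _)] at hH
  have hY : ∑ i ∈ Finset.range (n + 1), c i ^ (1 / θ) * d i ^ (1 / θ) ≤
      ∑ i ∈ Finset.range (n + 1),
        ((n : ℝ) + 1)⁻¹ * (A ^ (1 / (r * θ)) * B ^ (1 / (p * θ))) := by
    rw [Finset.sum_const, Finset.card_range, nsmul_eq_mul, ← mul_assoc]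
    push_cast
    rw [mul_inv_cancel₀ (by positivity), one_mul]
    refine hH.trans (mul_le_mul ?_ ?_ ?_ ?_)
    · exact Real.rpow_le_rpow (Finset.sum_nonneg fun i _ => Real.rpow_nonneg (hc i) _) hA
        (by positivity)
    · exact Real.rpow_le_rpow (Finset.sum_nonneg fun i _ => Real.rpow_nonneg (hd i) _) hB
        (by positivity)
    · exact Real.rpow_nonneg (Finset.sum_nonneg fun i _ => Real.rpow_nonneg (hd i) _) _
    · positivity
  obtain ⟨i, hi, hle⟩ := Finset.exists_le_of_sum_le (by simp) hY
  refine ⟨i, Nat.lt_succ_iff.1 (Finset.mem_range.1 hi), ?_⟩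
  have h1 := Real.rpow_le_rpow (by have := hc i; have := hd i; positivity) hle hθ0.le
  have e1 : ∀ z : ℝ, 0 ≤ z → (z ^ (1 / θ)) ^ θ = z := fun z hz => by
    simpa using e z 1 hz
  have e2 : ∀ z m : ℝ, 0 ≤ z → 0 < m → (z ^ (1 / (m * θ))) ^ θ = z ^ (1 / m) := fun z m hz hm => by
    rw [← Real.rpow_mul hz]
    congr 1
    field_simp
  rw [Real.mul_rpow (Real.rpow_nonneg (hc i) _) (Real.rpow_nonneg (hd i) _), e1 _ (hc i),
    e1 _ (hd i), Real.mul_rpow (by positivity) (by positivity),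
    Real.mul_rpow (by positivity) (by positivity), e2 _ _ hA0 hr, e2 _ _ hB0 hp,
    Real.inv_rpow (by positivity), ← Real.rpow_neg (by positivity)] at h1
  exact h1

lemma sum_range_skip {M : Type*} [AddCommGroup M] (φ : ℕ → ℕ → M) (i m : ℕ) :
    ∑ j ∈ Finset.range (i + m + 2), φ j (j + 1) =
      ∑ j ∈ Finset.range (i + m + 1),
        φ (if j ≤ i then j else j + 1) (if j + 1 ≤ i then j + 1 else j + 1 + 1) +
      (φ i (i + 1) + φ (i + 1) (i + 2) - φ i (i + 2)) := by
  induction m with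
  | zero =>
    have h : ∑ j ∈ Finset.range i,
        φ (if j ≤ i then j else j + 1) (if j + 1 ≤ i then j + 1 else j + 1 + 1) =
        ∑ j ∈ Finset.range i, φ j (j + 1) := by
      refine Finset.sum_congr rfl fun j hj => ?_
      have := Finset.mem_range.1 hj
      rw [if_pos (by omega), if_pos (by omega)]
    rw [add_zero, Finset.sum_range_succ _ (i + 1), Finset.sum_range_succ _ i,
      Finset.sum_range_succ _ i, h, if_pos le_rfl, if_neg (by omega)]
    abel
  | succ m ih =>
    rw [← add_assoc, Finset.sum_range_succ _ (i + m + 1 + 1), ih,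
      Finset.sum_range_succ _ (i + m + 1), if_neg (by omega), if_neg (by omega)]
    abel

/-- Young's inequality for left-point Riemann–Stieltjes sums. -/
lemma norm_left_sum_sub_le {k : ℝ → E →L[ℝ] F} {ω : ℝ → E} {r p s t A B : ℝ} (hr : 0 < r)
    (hp : 0 < p) (hk : MonoVarLE r k s t A) (hω : MonoVarLE p ω s t B) (n : ℕ) :
    ∀ u : ℕ → ℝ, Monotone u → (∀ i, u i ∈ Icc s t) →
    ‖∑ i ∈ Finset.range (n + 1), k (u i) (ω (u (i + 1)) - ω (u i)) -
        k (u 0) (ω (u (n + 1)) - ω (u 0))‖ ≤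
      (∑ j ∈ Finset.range n, ((j : ℝ) + 1) ^ (-(1 / p + 1 / r))) *
        (A ^ (1 / r) * B ^ (1 / p)) := by
  induction n with
  | zero => intro u _ _; simp
  | succ n ih =>
    intro u hu hmem
    obtain ⟨i, hi, hle⟩ := exists_mul_le_rpow (fun _ => norm_nonneg _) (fun _ => norm_nonneg _)
      hr hp (hk (n + 1) u hu hmem)
      (hω (n + 1) (fun j => u (j + 1)) (fun j l hjl => hu (by omega)) (fun j => hmem _))
    obtain ⟨m, rfl⟩ := Nat.exists_eq_add_of_le hi
    have hmono : Monotone fun j => u (if j ≤ i then j else j + 1) := by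
      intro j l hjl
      apply hu
      split_ifs <;> omega
    have h1 := ih (fun j => u (if j ≤ i then j else j + 1)) hmono (fun j => hmem _)
    have h2 := sum_range_skip (fun j l => k (u j) (ω (u l) - ω (u j))) i m
    simp only [Nat.zero_le, if_true, if_neg (by omega : ¬ (i + m + 1 ≤ i))] at h1
    rw [show i + m + 1 + 1 = i + m + 2 from rfl] at *
    rw [h2, Finset.sum_range_succ (fun j : ℕ => ((j : ℝ) + 1) ^ (-(1 / p + 1 / r))), add_mul]
    have h3 : k (u i) (ω (u (i + 1)) - ω (u i)) + k (u (i + 1)) (ω (u (i + 2)) - ω (u (i + 1))) -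
        k (u i) (ω (u (i + 2)) - ω (u i)) =
        (k (u (i + 1)) - k (u i)) (ω (u (i + 1 + 1)) - ω (u (i + 1))) := by
      simp only [sub_apply, map_sub, show i + 1 + 1 = i + 2 from rfl]
      abel
    rw [h3, add_sub_right_comm]
    exact (norm_add_le _ _).trans
      (add_le_add h1 ((ContinuousLinearMap.le_opNorm _ _).trans (by exact_mod_cast hle)))

lemma inv_one_sub_two_rpow_pos {θ : ℝ} (hθ : 1 < θ) : 0 < (1 - (2 : ℝ) ^ (1 - θ))⁻¹ := by
  have : (2 : ℝ) ^ (1 - θ) < 1 := Real.rpow_lt_one_of_one_lt_of_neg (by norm_num) (by linarith)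
  exact inv_pos.2 (by linarith)

/-- Young–Loève estimate for left-point Riemann–Stieltjes sums. -/
lemma norm_left_sum_sub_le_const {k : ℝ → E →L[ℝ] F} {ω : ℝ → E} {r p s t A B : ℝ} (hst : s ≤ t)
    (hr : 0 < r) (hp : 0 < p) (hθ : 1 < 1 / p + 1 / r) (hk : MonoVarLE r k s t A)
    (hω : MonoVarLE p ω s t B) (n : ℕ) (u : ℕ → ℝ) (hu : Monotone u)
    (hmem : ∀ i, u i ∈ Icc s t) (h0 : u 0 = s) (h1 : u (n + 1) = t) :
    ‖∑ i ∈ Finset.range (n + 1), k (u i) (ω (u (i + 1)) - ω (u i)) - k s (ω t - ω s)‖ ≤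
      (1 - (2 : ℝ) ^ (1 - (1 / p + 1 / r)))⁻¹ * (A ^ (1 / r) * B ^ (1 / p)) := by
  have h := norm_left_sum_sub_le hr hp hk hω n u hu hmem
  rw [h0, h1] at h
  have hA := hk.nonneg hst
  have hB := hω.nonneg hst
  exact h.trans (mul_le_mul_of_nonneg_right (sum_range_succ_rpow_neg_le hθ n) (by positivity))

/-- The `i`-th point of the uniform grid with `n + 1` cells on `[a,b]`. -/
def gridPt (a b : ℝ) (n i : ℕ) : ℝ := a + i * ((b - a) / (n + 1))

lemma gridPt_zero (a b : ℝ) (n : ℕ) : gridPt a b n 0 = a := by simp [gridPt]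

lemma gridPt_last (a b : ℝ) (n : ℕ) : gridPt a b n (n + 1) = b := by
  have : (n : ℝ) + 1 ≠ 0 := by positivity
  simp only [gridPt, Nat.cast_add, Nat.cast_one]
  field_simp
  ring

lemma gridPt_succ_sub (a b : ℝ) (n i : ℕ) :
    gridPt a b n (i + 1) - gridPt a b n i = (b - a) / (n + 1) := by
  simp only [gridPt, Nat.cast_add, Nat.cast_one]
  ring

lemma monotone_gridPt {a b : ℝ} (hab : a ≤ b) (n : ℕ) : Monotone (gridPt a b n) := by
  refine monotone_nat_of_le_succ fun i => ?_
  have h1 := gridPt_succ_sub a b n i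
  have h2 : 0 ≤ (b - a) / ((n : ℝ) + 1) := div_nonneg (by linarith) (by positivity)
  linarith

/-- The left-point sum on `[a,t]` along the uniform grid of `[a,b]`. -/
def gridSum (k : ℝ → E →L[ℝ] F) (ω : ℝ → E) (a b : ℝ) (n : ℕ) (t : ℝ) : F :=
  ∑ i ∈ Finset.range (n + 1), k (gridPt a b n i)
    (ω (min t (gridPt a b n (i + 1))) - ω (min t (gridPt a b n i)))

lemma gridSum_left (k : ℝ → E →L[ℝ] F) (ω : ℝ → E) {a b : ℝ} (hab : a ≤ b) (n : ℕ) :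
    gridSum k ω a b n a = 0 := by
  have h : ∀ i, min a (gridPt a b n i) = a := fun i => by
    rw [min_eq_left]
    simpa [gridPt_zero] using monotone_gridPt hab n (Nat.zero_le i)
  simp [gridSum, h]

lemma gridSum_sub (k : ℝ → E →L[ℝ] F) (ω : ℝ → E) (a b : ℝ) (n : ℕ) {s t : ℝ} (hst : s ≤ t) :
    gridSum k ω a b n t - gridSum k ω a b n s =
      ∑ i ∈ Finset.range (n + 1), k (gridPt a b n i)
        (ω (max s (min t (gridPt a b n (i + 1)))) - ω (max s (min t (gridPt a b n i)))) := by
  have h : ∀ z, ω (min t z) - ω (min s z) = ω (max s (min t z)) - ω s := fun z => by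
    rcases le_total z s with hz | hz
    · rw [min_eq_right hz, min_eq_right (hz.trans hst), max_eq_left hz]
      simp
    · rw [min_eq_left hz, max_eq_right (le_min hst hz)]
  rw [gridSum, gridSum, ← Finset.sum_sub_distrib]
  refine Finset.sum_congr rfl fun i _ => ?_
  rw [← map_sub]
  congr 1
  have h1 := h (gridPt a b n (i + 1))
  have h2 := h (gridPt a b n i)
  rw [sub_sub_sub_comm, h1, h2]
  abel

lemma norm_gridSum_sub_le {k : ℝ → E →L[ℝ] F} {ω : ℝ → E} {a b s t C ε M : ℝ} (has : a ≤ s)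
    (hst : s ≤ t) (htb : t ≤ b) (hε : 0 ≤ ε) (n : ℕ)
    (hC : ∀ u : ℕ → ℝ, Monotone u → (∀ i, u i ∈ Icc s t) → u 0 = s →
      u (n + 1) = t → ‖∑ i ∈ Finset.range (n + 1), k (u i) (ω (u (i + 1)) - ω (u i)) -
        k s (ω t - ω s)‖ ≤ C)
    (hk : ∀ z, a ≤ z → z ≤ s → s - z ≤ (b - a) / (n + 1) → ‖k z - k s‖ ≤ ε)
    (hω : ∀ c d, a ≤ c → c ≤ d → d ≤ b → ‖ω d - ω c‖ ≤ M) :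
    ‖gridSum k ω a b n t - gridSum k ω a b n s - k s (ω t - ω s)‖ ≤ C + ε * M := by
  have hab : a ≤ b := has.trans (hst.trans htb)
  have hM : 0 ≤ M := (norm_nonneg _).trans (hω a a le_rfl le_rfl hab)
  have hτ := monotone_gridPt hab n
  set τ := gridPt a b n with hτdef
  set v : ℕ → ℝ := fun i => max s (min t (τ i)) with hv
  have hvm : Monotone v := fun i j hij => max_le_max le_rfl (min_le_min le_rfl (hτ hij))
  have hvmem : ∀ i, v i ∈ Icc s t := fun i => ⟨le_max_left _ _, max_le hst (min_le_left _ _)⟩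
  have hv0 : v 0 = s := by
    simp only [hv, hτdef, gridPt_zero]
    rw [min_eq_right (has.trans hst), max_eq_left has]
  have hvn : v (n + 1) = t := by
    simp only [hv, hτdef, gridPt_last]
    rw [min_eq_left htb, max_eq_right hst]
  have h1 := hC v hvm hvmem hv0 hvn
  have h2 : gridSum k ω a b n t - gridSum k ω a b n s - k s (ω t - ω s) =
      (∑ i ∈ Finset.range (n + 1), k (v i) (ω (v (i + 1)) - ω (v i)) - k s (ω t - ω s)) +
      ∑ i ∈ Finset.range (n + 1), (k (τ i) - k (v i)) (ω (v (i + 1)) - ω (v i)) := by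
    rw [gridSum_sub k ω a b n hst]
    simp only [sub_apply, Finset.sum_sub_distrib]
    abel
  have h3 : ∀ i ∈ Finset.range (n + 1), (k (τ i) - k (v i)) (ω (v (i + 1)) - ω (v i)) ≠ 0 →
      τ i < s ∧ s < τ (i + 1) := by
    intro i _ hne
    by_contra hcon
    apply hne
    rw [not_and_or, not_lt, not_lt] at hcon
    rcases hcon with hcon | hcon
    · rcases le_total (τ i) t with hit | hit
      · have : v i = τ i := by simp only [hv]; rw [min_eq_right hit, max_eq_right hcon]
        rw [this, sub_self, zero_apply]
      · have e1 : v i = t := by simp only [hv]; rw [min_eq_left hit, max_eq_right hst]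
        have e2 : v (i + 1) = t := le_antisymm (hvmem _).2 (e1 ▸ hvm i.le_succ)
        rw [e1, e2, sub_self, map_zero]
    · have e2 : v (i + 1) = s := by
        simp only [hv]; rw [min_eq_right (hcon.trans hst), max_eq_left hcon]
      have e1 : v i = s := le_antisymm (e2 ▸ hvm i.le_succ) (hvmem _).1
      rw [e1, e2, sub_self, map_zero]
  have h4 : ‖∑ i ∈ Finset.range (n + 1), (k (τ i) - k (v i)) (ω (v (i + 1)) - ω (v i))‖ ≤
      ε * M := by
    rw [← Finset.sum_filter_of_ne h3]
    have hcard : ((Finset.range (n + 1)).filter fun i => τ i < s ∧ s < τ (i + 1)).card ≤ 1 := by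
      rw [Finset.card_le_one]
      intro i hi j hj
      have hi := (Finset.mem_filter.1 hi).2
      have hj := (Finset.mem_filter.1 hj).2
      rcases lt_trichotomy i j with hij | hij | hij
      · have := hτ (Nat.succ_le_of_lt hij)
        exact absurd (hi.2.trans_le this) (not_lt.2 hj.1.le)
      · exact hij
      · have := hτ (Nat.succ_le_of_lt hij)
        exact absurd (hj.2.trans_le this) (not_lt.2 hi.1.le)
    refine (norm_sum_le _ _).trans ((Finset.sum_le_card_nsmul _ _ (ε * M) ?_).trans ?_)
    · intro i hi
      have hi := (Finset.mem_filter.1 hi).2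
      have e1 : v i = s := by
        simp only [hv]; rw [min_eq_right (hi.1.le.trans hst), max_eq_left hi.1.le]
      have hai : a ≤ τ i := by
        simpa [hτdef, gridPt_zero] using hτ (Nat.zero_le i)
      have hgap := gridPt_succ_sub a b n i
      refine (ContinuousLinearMap.le_opNorm _ _).trans (mul_le_mul ?_ ?_ (norm_nonneg _) hε)
      · rw [e1]
        exact hk _ hai hi.1.le (by linarith [hi.2])
      · exact hω _ _ (has.trans (hvmem _).1) (hvm i.le_succ) ((hvmem _).2.trans htb)
    · rw [nsmul_eq_mul]
      have : (((Finset.range (n + 1)).filter fun i => τ i < s ∧ s < τ (i + 1)).card : ℝ) ≤ 1 := by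
        exact_mod_cast hcard
      have h0 : 0 ≤ ε * M := mul_nonneg hε hM
      nlinarith
  rw [h2]
  exact (norm_add_le _ _).trans (add_le_add h1 h4)

/-- A function whose increments are the Young integrals of `k` against `ω`: they satisfy every
bound which holds for all left-point sums. -/
lemma exists_young_primitive [ProperSpace F] {k : ℝ → E →L[ℝ] F} {ω : ℝ → E} {a b r p A B : ℝ}
    (hab : a ≤ b) (hr : 0 < r) (hp : 0 < p) (hθ : 1 < 1 / p + 1 / r)
    (hkc : ContinuousOn k (Icc a b)) (hk : MonoVarLE r k a b A) (hω : MonoVarLE p ω a b B) :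
    ∃ J : ℝ → F, ∀ s t, a ≤ s → s ≤ t → t ≤ b → ∀ C,
      (∀ (n : ℕ) (u : ℕ → ℝ), Monotone u → (∀ i, u i ∈ Icc s t) → u 0 = s → u (n + 1) = t →
        ‖∑ i ∈ Finset.range (n + 1), k (u i) (ω (u (i + 1)) - ω (u i)) - k s (ω t - ω s)‖ ≤ C) →
      ‖J t - J s - k s (ω t - ω s)‖ ≤ C := by
  have hM : ∀ c d, a ≤ c → c ≤ d → d ≤ b → ‖ω d - ω c‖ ≤ B ^ (1 / p) := fun c d hc hcd hd =>
    hω.norm_le hp hc hcd hd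
  have hM0 : 0 ≤ B ^ (1 / p) := (norm_nonneg _).trans (hM a a le_rfl le_rfl hab)
  have hlim : ∀ t, ∃ l : F, t ∈ Icc a b →
      Filter.Tendsto (fun n => gridSum k ω a b n t) (Filter.hyperfilter ℕ) (nhds l) := by
    intro t
    by_cases ht : t ∈ Icc a b
    swap
    · exact ⟨0, fun h => absurd h ht⟩
    set C := (1 - (2 : ℝ) ^ (1 - (1 / p + 1 / r)))⁻¹ * (A ^ (1 / r) * B ^ (1 / p)) with hCdef
    have hbd : ∀ n, gridSum k ω a b n t ∈ Metric.closedBall (k a (ω t - ω a)) C := by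
      intro n
      have h := norm_gridSum_sub_le (k := k) (ω := ω) (C := C) le_rfl ht.1 ht.2 le_rfl n
        (fun u hu hmem h0 h1 => norm_left_sum_sub_le_const ht.1 hr hp hθ
          (hk.mono le_rfl ht.2 le_rfl) (hω.mono le_rfl ht.2 le_rfl) n u hu hmem h0 h1)
        (fun z hz hz' _ => by rw [le_antisymm hz' hz, sub_self, norm_zero]) hM
      rw [gridSum_left k ω hab, sub_zero, zero_mul, add_zero] at h
      rwa [mem_closedBall_iff_norm]
    have hmem : ((Filter.hyperfilter ℕ).map fun n => gridSum k ω a b n t : Filter F) ≤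
        Filter.principal (Metric.closedBall (k a (ω t - ω a)) C) := by
      rw [Filter.le_principal_iff]
      exact Filter.mem_map.2 (Filter.univ_mem' hbd)
    obtain ⟨l, -, hl⟩ := (isCompact_closedBall (k a (ω t - ω a)) C).ultrafilter_le_nhds
      ((Filter.hyperfilter ℕ).map fun n => gridSum k ω a b n t) hmem
    exact ⟨l, fun _ => hl⟩
  choose J hJ using hlim
  refine ⟨J, fun s t has hst htb C hC => ?_⟩
  have hs : s ∈ Icc a b := ⟨has, hst.trans htb⟩
  have ht : t ∈ Icc a b := ⟨has.trans hst, htb⟩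
  have hT := (((hJ t ht).sub (hJ s hs)).sub_const (k s (ω t - ω s))).norm
  have key : ∀ ε > 0, ‖J t - J s - k s (ω t - ω s)‖ ≤ C + ε * B ^ (1 / p) := by
    intro ε hε
    obtain ⟨η, hη, hcont⟩ := Metric.continuousWithinAt_iff.1 (hkc s hs) ε hε
    obtain ⟨N, hN⟩ := exists_nat_gt ((b - a) / η)
    refine le_of_tendsto hT ?_
    have hev : ∀ᶠ n in (Filter.atTop : Filter ℕ), N ≤ n := Filter.eventually_ge_atTop N
    refine (Filter.Eventually.filter_mono ?_ hev).mono fun n hn => ?_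
    · rw [← Nat.cofinite_eq_atTop]
      exact Filter.hyperfilter_le_cofinite
    · refine norm_gridSum_sub_le has hst htb hε.le n (hC n) (fun z hz hzs hd => ?_) hM
      have hlt : (b - a) / ((n : ℝ) + 1) < η := by
        rw [div_lt_comm₀ (by positivity) hη]
        have : (N : ℝ) ≤ n := by exact_mod_cast hn
        linarith
      have := hcont (x := z) ⟨hz, hzs.trans hs.2⟩ (by
        rw [Real.dist_eq, abs_sub_comm, abs_of_nonneg (by linarith)]
        linarith)
      rw [dist_eq_norm] at this
      exact this.le
  refine le_of_forall_pos_le_add fun ε hε => ?_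
  refine (key (ε / (B ^ (1 / p) + 1)) (by positivity)).trans ?_
  have : ε / (B ^ (1 / p) + 1) * B ^ (1 / p) ≤ ε := by
    rw [div_mul_eq_mul_div, div_le_iff₀ (by positivity)]
    nlinarith
  linarith

lemma isYoungIntegral_of_primitive {k : ℝ → E →L[ℝ] F} {ω : ℝ → E} {J : ℝ → F} {a b r p A B : ℝ}
    (hr : 0 < r) (hp : 1 < p) (hθ : 1 < 1 / p + 1 / r)
    (hkc : ContinuousOn k (Icc a b)) (hk : MonoVarLE r k a b A) (hω : MonoVarLE p ω a b B)
    (hJ : ∀ s t, a ≤ s → s ≤ t → t ≤ b → ∀ C,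
      (∀ (n : ℕ) (u : ℕ → ℝ), Monotone u → (∀ i, u i ∈ Icc s t) → u 0 = s → u (n + 1) = t →
        ‖∑ i ∈ Finset.range (n + 1), k (u i) (ω (u (i + 1)) - ω (u i)) - k s (ω t - ω s)‖ ≤ C) →
      ‖J t - J s - k s (ω t - ω s)‖ ≤ C)
    {s t : ℝ} (has : a ≤ s) (htb : t ≤ b) :
    IsYoungIntegral k ω s t (J t - J s) := by
  intro ε hε
  have hp0 : 0 < p := by linarith
  have hpinv : 1 / p < 1 := by rw [div_lt_one hp0]; exact hp
  obtain ⟨r', hr'0, hrr', hθ'⟩ : ∃ r' : ℝ, 0 < r' ∧ r < r' ∧ 1 < 1 / p + 1 / r' := by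
    have h1 : 0 < 1 / r + (1 - 1 / p) := by have : 0 < 1 / r := by positivity
                                            linarith
    refine ⟨2 / (1 / r + (1 - 1 / p)), by positivity, ?_, ?_⟩
    · rw [lt_div_iff₀ h1, mul_add, mul_one_div_cancel hr.ne']
      have : r * (1 - 1 / p) < r * (1 / r) := mul_lt_mul_of_pos_left (by linarith) hr
      rw [mul_one_div_cancel hr.ne'] at this
      linarith
    · rw [one_div_div]
      linarith
  set θ := 1 / p + 1 / r' with hθdef
  set W : ℝ → ℝ → ℝ := fun c d => sSup (pVarSums r k c d) + sSup (pVarSums p ω c d) with hW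
  have hW0 : ∀ c d : ℝ, 0 ≤ W c d := fun c d =>
    add_nonneg (sSup_pVarSums_nonneg _ _ _ _) (sSup_pVarSums_nonneg _ _ _ _)
  have hWadd : ∀ c d e : ℝ, s ≤ c → c ≤ d → d ≤ e → e ≤ t → W c d + W d e ≤ W c e := by
    intro c d e hc hcd hde he
    have h1 := sSup_pVarSums_add_le hr hk.finitePVar (has.trans hc) hcd hde (he.trans htb)
    have h2 := sSup_pVarSums_add_le hp0 hω.finitePVar (has.trans hc) hcd hde (he.trans htb)
    simp only [hW]
    linarith
  set K := (1 - (2 : ℝ) ^ (1 - θ))⁻¹ with hK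
  have hK0 : 0 < K := inv_one_sub_two_rpow_pos hθ'
  set Q := (K + 1) * W s t ^ θ with hQ
  have hQ0 : 0 ≤ Q := mul_nonneg (by linarith) (Real.rpow_nonneg (hW0 _ _) _)
  set κ := (r' - r) / r' with hκ
  have hκ0 : 0 < κ := div_pos (by linarith) hr'0
  set ζ := ε / (Q + 1) with hζ
  have hζ0 : 0 < ζ := by positivity
  set η := ζ ^ (1 / κ) with hη
  have hη0 : 0 < η := Real.rpow_pos_of_pos hζ0 _
  have hηκ : η ^ κ = ζ := by
    rw [hη, ← Real.rpow_mul hζ0.le, one_div_mul_cancel hκ0.ne', Real.rpow_one]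
  obtain ⟨δ, hδ, hunif⟩ := Metric.uniformContinuousOn_iff.1
    (isCompact_Icc.uniformContinuousOn_of_continuous hkc) η hη0
  refine ⟨δ, hδ, fun P hP => ?_⟩
  have hmono := P.mono.monotone
  have hmem : ∀ i, P.t i ∈ Icc s t := fun i => by
    have h1 := hmono (Fin.zero_le i)
    have h2 := hmono (Fin.le_last i)
    rw [P.first] at h1
    rw [P.last] at h2
    exact ⟨h1, h2⟩
  have htel : J t - J s = ∑ i : Fin P.n, (J (P.t i.succ) - J (P.t i.castSucc)) := by
    rw [sum_fin_eq_sum_range_seqOfFin P.t fun c d => J d - J c,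
      Finset.sum_range_sub fun i => J (seqOfFin P.t i), seqOfFin_zero, seqOfFin_last, P.first,
      P.last]
  have hterm : ∀ i : Fin P.n, ‖k (P.tag i) (ω (P.t i.succ) - ω (P.t i.castSucc)) -
      (J (P.t i.succ) - J (P.t i.castSucc))‖ ≤
      (K + 1) * ζ * W (P.t i.castSucc) (P.t i.succ) ^ θ := by
    intro i
    obtain ⟨hc1, hd1⟩ := P.tag_mem i
    have hcs := (hmem i.castSucc).1
    have hdt := (hmem i.succ).2
    have hgap : P.t i.succ - P.t i.castSucc < δ :=
      (le_ciSup (f := fun i : Fin P.n => P.t i.succ - P.t i.castSucc)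
        (Set.finite_range _).bddAbove i).trans_lt hP
    generalize P.t i.castSucc = c at *
    generalize P.t i.succ = d at *
    generalize P.tag i = ξ at *
    have hcd : c ≤ d := hc1.trans hd1
    have hac : a ≤ c := has.trans hcs
    have hdb : d ≤ b := hdt.trans htb
    have hVk : MonoVarLE r k c d (sSup (pVarSums r k c d)) :=
      ((hk.mono hac hdb le_rfl).finitePVar).monoVarLE hr
    have hVω : MonoVarLE p ω c d (sSup (pVarSums p ω c d)) :=
      ((hω.mono hac hdb le_rfl).finitePVar).monoVarLE hp0
    have hosc : ∀ y ∈ Icc c d, ∀ z ∈ Icc c d, ‖k z - k y‖ ≤ η := by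
      intro y hy z hz
      have := hunif z ⟨hac.trans hz.1, hz.2.trans hdb⟩ y ⟨hac.trans hy.1, hy.2.trans hdb⟩ (by
        rw [Real.dist_eq, abs_lt]
        constructor <;> linarith [hy.1, hy.2, hz.1, hz.2])
      rw [dist_eq_norm] at this
      exact this.le
    have hVk' := hVk.of_osc_le hr hrr'.le hosc
    set X := (η ^ (r' - r) * sSup (pVarSums r k c d)) ^ (1 / r') *
      sSup (pVarSums p ω c d) ^ (1 / p) with hX
    have hVk0 := sSup_pVarSums_nonneg r c d k
    have hVω0 := sSup_pVarSums_nonneg p c d ω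
    have hXle : X ≤ ζ * W c d ^ θ := by
      have e1 : (η ^ (r' - r) * sSup (pVarSums r k c d)) ^ (1 / r') =
          ζ * sSup (pVarSums r k c d) ^ (1 / r') := by
        rw [Real.mul_rpow (by positivity) hVk0, ← Real.rpow_mul hη0.le, mul_one_div, ← hκ, hηκ]
      rw [hX, e1, mul_assoc, hθdef, add_comm (1 / p),
        Real.rpow_add_of_nonneg (hW0 c d) (by positivity) (by positivity)]
      refine mul_le_mul_of_nonneg_left (mul_le_mul ?_ ?_ (by positivity)
        (Real.rpow_nonneg (hW0 c d) _)) hζ0.le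
      · exact Real.rpow_le_rpow hVk0 (by simp only [hW]; linarith) (by positivity)
      · exact Real.rpow_le_rpow hVω0 (by simp only [hW]; linarith) (by positivity)
    have h1 : ‖J d - J c - k c (ω d - ω c)‖ ≤ K * X :=
      hJ c d hac hcd hdb _ fun n u hu hmem h0 h1 =>
        norm_left_sum_sub_le_const hcd hr'0 hp0 hθ' hVk' hVω n u hu hmem h0 h1
    have h2 : ‖(k ξ - k c) (ω d - ω c)‖ ≤ X :=
      (ContinuousLinearMap.le_opNorm _ _).trans (mul_le_mul (hVk'.norm_le hr'0 le_rfl hc1 hd1)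
        (hVω.norm_le hp0 le_rfl hcd le_rfl) (norm_nonneg _) (by positivity))
    have e : k ξ (ω d - ω c) - (J d - J c) =
        (k ξ - k c) (ω d - ω c) - (J d - J c - k c (ω d - ω c)) := by
      rw [sub_apply]
      abel
    rw [e]
    refine (norm_sub_le _ _).trans ((add_le_add h2 h1).trans ?_)
    have : (K + 1) * X ≤ (K + 1) * (ζ * W c d ^ θ) :=
      mul_le_mul_of_nonneg_left hXle (by linarith)
    linarith
  have hsum := Finset.sum_le_sum fun i (_ : i ∈ (Finset.univ : Finset (Fin P.n))) => hterm i
  rw [← Finset.mul_sum, sum_fin_eq_sum_range_seqOfFin P.t fun c d => W c d ^ θ] at hsum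
  have hWsum := sum_superadditive_rpow_le hWadd (fun c d _ _ _ => hW0 c d) hθ'.le
    (monotone_seqOfFin hmono) (fun i => by
      simpa only [P.first, P.last] using seqOfFin_mem_Icc hmono i) P.n
  rw [RSSum, htel, ← Finset.sum_sub_distrib]
  refine (norm_sum_le _ _).trans_lt (hsum.trans_lt ?_)
  refine (mul_le_mul_of_nonneg_left hWsum (by positivity)).trans_lt ?_
  have : (K + 1) * ζ * W s t ^ θ = Q * ε / (Q + 1) := by
    rw [hQ, hζ]
    ring
  rw [this, div_lt_iff₀ (by positivity)]
  nlinarith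

lemma exists_taggedPartition_mesh_lt {s t δ : ℝ} (hst : s ≤ t) (hδ : 0 < δ) :
    ∃ P : TaggedPartition s t, P.mesh < δ := by
  rcases hst.eq_or_lt with rfl | h
  · refine ⟨⟨0, fun _ => s, fun i => i.elim0, fun i j hij => by omega, rfl, rfl,
      fun i => i.elim0⟩, ?_⟩
    unfold TaggedPartition.mesh
    dsimp only
    rw [Real.iSup_of_isEmpty]
    exact hδ
  · obtain ⟨n, hn⟩ := exists_nat_gt ((t - s) / δ)
    have hpos : 0 < (t - s) / ((n : ℝ) + 1) := div_pos (by linarith) (by positivity)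
    have hmono : StrictMono (gridPt s t n) := strictMono_nat_of_lt_succ fun i => by
      linarith [gridPt_succ_sub s t n i]
    refine ⟨⟨n + 1, fun i => gridPt s t n i, fun i => gridPt s t n i,
      fun i j hij => hmono hij, gridPt_zero s t n, gridPt_last s t n,
      fun i => ⟨le_rfl, hmono.monotone (by simp)⟩⟩, ?_⟩
    unfold TaggedPartition.mesh
    refine (ciSup_le fun i => ?_).trans_lt (b := (t - s) / ((n : ℝ) + 1)) ?_
    · exact (gridPt_succ_sub s t n i).le
    · rw [div_lt_comm₀ (by positivity) hδ]
      linarith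

lemma IsYoungIntegral.unique {k : ℝ → E →L[ℝ] F} {ω : ℝ → E} {s t : ℝ} (hst : s ≤ t) {v w : F}
    (hv : IsYoungIntegral k ω s t v) (hw : IsYoungIntegral k ω s t w) : v = w := by
  refine eq_of_forall_dist_le fun ε hε => ?_
  obtain ⟨δ₁, h1, hv⟩ := hv (ε / 2) (by linarith)
  obtain ⟨δ₂, h2, hw⟩ := hw (ε / 2) (by linarith)
  obtain ⟨P, hP⟩ := exists_taggedPartition_mesh_lt hst (lt_min h1 h2)
  have h3 := hv P (hP.trans_le (min_le_left _ _))
  have h4 := hw P (hP.trans_le (min_le_right _ _))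
  rw [← dist_eq_norm] at h3 h4
  linarith [dist_triangle_left v w (RSSum k ω P)]

lemma IsYoungIntegral.youngIntegral_eq {k : ℝ → E →L[ℝ] F} {ω : ℝ → E} {s t : ℝ} (hst : s ≤ t)
    {v : F} (hv : IsYoungIntegral k ω s t v) : youngIntegral k ω s t = v := by
  have hex : ∃ v, IsYoungIntegral k ω s t v := ⟨v, hv⟩
  unfold youngIntegral
  rw [dif_pos hex]
  exact hex.choose_spec.unique hst hv

lemma IsYoungIntegral.sub {k l : ℝ → E →L[ℝ] F} {ω : ℝ → E} {s t : ℝ} {v w : F}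
    (hv : IsYoungIntegral k ω s t v) (hw : IsYoungIntegral l ω s t w) :
    IsYoungIntegral (fun z => k z - l z) ω s t (v - w) := by
  intro ε hε
  obtain ⟨δ₁, h1, hv⟩ := hv (ε / 2) (by linarith)
  obtain ⟨δ₂, h2, hw⟩ := hw (ε / 2) (by linarith)
  refine ⟨min δ₁ δ₂, lt_min h1 h2, fun P hP => ?_⟩
  have h3 := hv P (hP.trans_le (min_le_left _ _))
  have h4 := hw P (hP.trans_le (min_le_right _ _))
  have e : RSSum (fun z => k z - l z) ω P - (v - w) = (RSSum k ω P - v) - (RSSum l ω P - w) := by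
    simp only [RSSum, sub_apply, Finset.sum_sub_distrib]
    abel
  rw [e]
  linarith [norm_sub_le (RSSum k ω P - v) (RSSum l ω P - w)]

/-- Existence of the Young integral, additivity in the interval, and the Young–Loève estimate. -/
lemma exists_young_integral [ProperSpace F] {k : ℝ → E →L[ℝ] F} {ω : ℝ → E} {a b r p A B : ℝ}
    (hab : a ≤ b) (hr : 0 < r) (hp : 1 < p) (hθ : 1 < 1 / p + 1 / r)
    (hkc : ContinuousOn k (Icc a b)) (hk : MonoVarLE r k a b A) (hω : MonoVarLE p ω a b B) :
    ∃ J : ℝ → F,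
      (∀ s t, a ≤ s → s ≤ t → t ≤ b → IsYoungIntegral k ω s t (J t - J s)) ∧
      ∀ s t, a ≤ s → s ≤ t → t ≤ b → ‖J t - J s - k s (ω t - ω s)‖ ≤
        (1 - (2 : ℝ) ^ (1 - (1 / p + 1 / r)))⁻¹ * (A ^ (1 / r) * pVar p ω s t) := by
  have hp0 : 0 < p := by linarith
  obtain ⟨J, hJ⟩ := exists_young_primitive hab hr hp0 hθ hkc hk hω
  refine ⟨J, fun s t has _ htb => isYoungIntegral_of_primitive hr hp hθ hkc hk hω hJ has htb,
    fun s t has hst htb => hJ s t has hst htb _ fun n u hu hmem h0 h1 => ?_⟩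
  exact norm_left_sum_sub_le_const hst hr hp0 hθ (hk.mono has htb le_rfl)
    ((hω.mono has htb le_rfl).finitePVar.monoVarLE hp0) n u hu hmem h0 h1

end YoungLemmas

section CompositionLemmas

variable {E G : Type*} [NormedAddCommGroup E] [NormedAddCommGroup G]

lemma FinitePVar.monoVarLE_of_le {r r' s t : ℝ} (hr : 0 < r) (hrr' : r ≤ r') {x : ℝ → E}
    (hx : FinitePVar r x s t) : MonoVarLE r' x s t (pVar r x s t ^ r') := fun n u hu hmem =>
  sum_rpow_le_of_sum_rpow_le _ (fun _ => norm_nonneg _) hr hrr' (pVar_nonneg _ _ _ _)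
    ((hx.monoVarLE hr n u hu hmem).trans_eq (pVar_rpow hr s t x).symm)

lemma FinitePVar.sub {r s t : ℝ} (hr : 1 ≤ r) {x y : ℝ → E} (hx : FinitePVar r x s t)
    (hy : FinitePVar r y s t) : FinitePVar r (fun z => x z - y z) s t := by
  have hr0 : 0 < r := by linarith
  refine MonoVarLE.finitePVar (V := (pVar r x s t + pVar r y s t) ^ r) fun n u hu hmem => ?_
  refine sum_rpow_le_of_le_add _ hr (fun _ _ => norm_nonneg _) (fun _ _ => norm_nonneg _)
    (fun _ _ => norm_nonneg _) (pVar_nonneg _ _ _ _) (pVar_nonneg _ _ _ _) (fun i _ => ?_)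
    (hx.monoVarLE_of_le hr0 le_rfl n u hu hmem) (hy.monoVarLE_of_le hr0 le_rfl n u hu hmem)
  rw [sub_sub_sub_comm]
  exact norm_sub_le _ _

lemma IsControlOn.sum_rpow_le {T : ℝ} {h : ℝ → ℝ → ℝ} (hh : IsControlOn 0 T h) {β r : ℝ}
    (hβr : 1 ≤ β * r) {u : ℕ → ℝ} (hu : Monotone u) (hmem : ∀ i, u i ∈ Icc 0 T) (n : ℕ) :
    ∑ i ∈ Finset.range n, (h (u i) (u (i + 1)) ^ β) ^ r ≤ (h 0 T ^ β) ^ r := by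
  obtain ⟨-, -, hadd, hnonneg⟩ := hh
  have hT : 0 ≤ T := (hmem 0).1.trans (hmem 0).2
  rw [← Real.rpow_mul (hnonneg 0 T le_rfl hT le_rfl)]
  rw [Finset.sum_congr rfl fun i _ => (Real.rpow_mul
    (hnonneg _ _ (hmem i).1 (hu i.le_succ) (hmem (i + 1)).2) β r).symm]
  exact sum_superadditive_rpow_le hadd hnonneg hβr hu hmem n

lemma IsControlOn.norm_sub_le_of_lt {T β : ℝ} {h : ℝ → ℝ → ℝ} (hh : IsControlOn 0 T h)
    {φ : ℝ → G} (hφ : ∀ s t, 0 ≤ s → s < t → t ≤ T → ‖φ t - φ s‖ ≤ h s t ^ β) {s t : ℝ}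
    (hs : 0 ≤ s) (hst : s ≤ t) (ht : t ≤ T) : ‖φ t - φ s‖ ≤ h s t ^ β := by
  rcases hst.eq_or_lt with rfl | hlt
  · rw [sub_self, norm_zero]
    exact Real.rpow_nonneg (hh.2.2.2 s s hs le_rfl ht) β
  · exact hφ s t hs hlt ht

lemma monoVarLE_comp {g : ℝ → E → G} {x : ℝ → E} {T t0 t1 β r q L : ℝ} {h : ℝ → ℝ → ℝ}
    (hh : IsControlOn 0 T h) (hβr : 1 ≤ β * r) (hr : 1 ≤ r) (hq : 0 < q) (hqr : q ≤ r)
    (hL : 0 ≤ L) (ht0 : 0 ≤ t0) (ht01 : t0 ≤ t1) (ht1 : t1 ≤ T) (hx : FinitePVar q x t0 t1)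
    (hgL : ∀ t ∈ Icc 0 T, ∀ v w, ‖g t v - g t w‖ ≤ L * ‖v - w‖)
    (hgh : ∀ s t, 0 ≤ s → s ≤ t → t ≤ T → ∀ v, ‖g t v - g s v‖ ≤ h s t ^ β) :
    MonoVarLE r (fun s => g s (x s)) t0 t1 ((L * pVar q x t0 t1 + h 0 T ^ β) ^ r) := by
  intro n u hu hmem
  have hT : 0 ≤ T := ht0.trans (ht01.trans ht1)
  have hmem' : ∀ i, u i ∈ Icc 0 T := fun i => ⟨ht0.trans (hmem i).1, (hmem i).2.trans ht1⟩
  have hnonneg : ∀ i, 0 ≤ h (u i) (u (i + 1)) ^ β := fun i =>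
    Real.rpow_nonneg (hh.2.2.2 _ _ (hmem' i).1 (hu i.le_succ) (hmem' _).2) _
  refine sum_rpow_le_of_le_add _ hr (fun _ _ => norm_nonneg _)
    (c := fun i => L * ‖x (u (i + 1)) - x (u i)‖) (d := fun i => h (u i) (u (i + 1)) ^ β)
    (fun _ _ => by positivity) (fun i _ => hnonneg i) (mul_nonneg hL (pVar_nonneg _ _ _ _))
    (Real.rpow_nonneg (hh.2.2.2 0 T le_rfl hT le_rfl) _) (fun i _ => ?_) ?_
    (hh.sum_rpow_le hβr hu hmem' n)
  · have h1 := hgL _ (hmem' (i + 1)) (x (u (i + 1))) (x (u i))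
    have h2 := hgh (u i) (u (i + 1)) (hmem' i).1 (hu i.le_succ) (hmem' _).2 (x (u i))
    exact (norm_sub_le_norm_sub_add_norm_sub _ _ _).trans (add_le_add h1 h2)
  · exact sum_const_mul_rpow_le _ hL (pVar_nonneg _ _ _ _) (fun _ _ => norm_nonneg _)
      (hx.monoVarLE_of_le hq hqr n u hu hmem)

lemma FinitePVar.norm_sub_le_pVar {r s t c d : ℝ} (hr : 0 < r) {x : ℝ → E}
    (hx : FinitePVar r x s t) (hc : s ≤ c) (hcd : c ≤ d) (hd : d ≤ t) :
    ‖x d - x c‖ ≤ pVar r x c d :=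
  ((hx.mono hr hc hd).monoVarLE hr).norm_le hr le_rfl hcd le_rfl

lemma pVar_le_of_norm_sub_le {z : ℝ → G} {ω : ℝ → E} {p q s t A B : ℝ} (hst : s ≤ t) (hp : 0 < p)
    (hpq : p ≤ q) (hq : 1 ≤ q) (hA : 0 ≤ A) (hB : 0 ≤ B) (hω : FinitePVar p ω s t)
    (hz : ∀ c d, s ≤ c → c ≤ d → d ≤ t → ‖z d - z c‖ ≤ A * (d - c) + B * pVar p ω c d) :
    pVar q z s t ≤ A * (t - s) + B * pVar p ω s t := by
  have hts : 0 ≤ t - s := by linarith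
  have hAts : 0 ≤ A * (t - s) := mul_nonneg hA hts
  have hBω : 0 ≤ B * pVar p ω s t := mul_nonneg hB (pVar_nonneg _ _ _ _)
  refine pVar_le_of_monoVarLE hst (hp.trans_le hpq) (add_nonneg hAts hBω) fun n u hu hmem => ?_
  have hlen : ∀ i, 0 ≤ u (i + 1) - u i := fun i => by linarith [hu i.le_succ]
  refine sum_rpow_le_of_le_add _ hq (fun _ _ => norm_nonneg _)
    (fun i _ => mul_nonneg hA (hlen i)) (fun i _ => mul_nonneg hB (pVar_nonneg _ _ _ _)) hAts hBω
    (fun i _ => hz _ _ (hmem i).1 (hu i.le_succ) (hmem (i + 1)).2)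
    (sum_const_mul_rpow_le _ hA hts (fun i _ => hlen i) ?_)
    (sum_const_mul_rpow_le _ hB (pVar_nonneg _ _ _ _) (fun _ _ => pVar_nonneg _ _ _ _) ?_)
  · exact sum_superadditive_rpow_le (w := fun c d => d - c)
      (fun c d e _ _ _ _ => by linarith) (fun c d _ _ _ => by linarith) hq hu hmem n
  · refine sum_rpow_le_of_sum_rpow_le _ (fun _ => pVar_nonneg _ _ _ _) hp hpq
      (pVar_nonneg _ _ _ _) ?_
    rw [Finset.sum_congr rfl fun i _ => pVar_rpow hp _ _ ω, pVar_rpow hp]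
    exact sum_superadditive_le (w := fun c d => sSup (pVarSums p ω c d))
      (fun c d e hc hcd hde he => sSup_pVarSums_add_le hp hω hc hcd hde he)
      (fun c d _ _ _ => sSup_pVarSums_nonneg _ _ _ _) hu hmem n

variable [NormedSpace ℝ E] [NormedSpace ℝ G]

lemma norm_four_point_le {g : E → G} {D : E → E →L[ℝ] G} {L N M δ : ℝ}
    (hD : ∀ v, HasFDerivAt g (D v) v) (hL : ∀ v, ‖D v‖ ≤ L) (hM0 : 0 ≤ M) (hδ0 : 0 < δ)
    (hδ1 : δ ≤ 1)
    (hM : ∀ v w, ‖v‖ ≤ N → ‖w‖ ≤ N → ‖D v - D w‖ ≤ M * ‖v - w‖ ^ δ) {x₁ y₁ x₂ y₂ : E}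
    (hx₁ : ‖x₁‖ ≤ N) (hy₁ : ‖y₁‖ ≤ N) (hx₂ : ‖x₂‖ ≤ N) (hy₂ : ‖y₂‖ ≤ N) :
    ‖g x₂ - g y₂ - (g x₁ - g y₁)‖ ≤ L * ‖(x₂ - y₂) - (x₁ - y₁)‖ +
      M * ‖x₁ - y₁‖ * (‖x₂ - x₁‖ ^ δ + ‖y₂ - y₁‖ ^ δ) := by
  have hline : ∀ (x y : E) (r : ℝ),
      HasDerivAt (fun r : ℝ => g (y + r • (x - y))) (D (y + r • (x - y)) (x - y)) r := by
    intro x y r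
    have h1 : HasDerivAt (fun r : ℝ => y + r • (x - y)) (x - y) r := by
      simpa using ((hasDerivAt_id r).smul_const (x - y)).const_add y
    exact (hD _).comp_hasDerivAt r h1
  have hball : ∀ (x y : E) (r : ℝ), ‖x‖ ≤ N → ‖y‖ ≤ N → r ∈ Ico (0 : ℝ) 1 →
      ‖y + r • (x - y)‖ ≤ N := by
    intro x y r hx hy hr
    have e : y + r • (x - y) = (1 - r) • y + r • x := by module
    rw [e]
    refine (norm_add_le _ _).trans ?_
    rw [norm_smul, norm_smul, Real.norm_of_nonneg hr.1,
      Real.norm_of_nonneg (by linarith [hr.2] : 0 ≤ 1 - r)]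
    nlinarith [hr.1, hr.2]
  have hder : ∀ r ∈ Icc (0 : ℝ) 1, HasDerivWithinAt
      (fun r : ℝ => g (y₂ + r • (x₂ - y₂)) - g (y₁ + r • (x₁ - y₁)))
      (D (y₂ + r • (x₂ - y₂)) (x₂ - y₂) - D (y₁ + r • (x₁ - y₁)) (x₁ - y₁)) (Icc 0 1) r :=
    fun r _ => ((hline x₂ y₂ r).sub (hline x₁ y₁ r)).hasDerivWithinAt
  have hbound : ∀ r ∈ Ico (0 : ℝ) 1,
      ‖D (y₂ + r • (x₂ - y₂)) (x₂ - y₂) - D (y₁ + r • (x₁ - y₁)) (x₁ - y₁)‖ ≤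
      L * ‖(x₂ - y₂) - (x₁ - y₁)‖ + M * ‖x₁ - y₁‖ * (‖x₂ - x₁‖ ^ δ + ‖y₂ - y₁‖ ^ δ) := by
    intro r hr
    set v := y₂ + r • (x₂ - y₂) with hv
    set w := y₁ + r • (x₁ - y₁) with hw
    have e : D v (x₂ - y₂) - D w (x₁ - y₁) =
        D v ((x₂ - y₂) - (x₁ - y₁)) + (D v - D w) (x₁ - y₁) := by
      rw [map_sub (D v) (x₂ - y₂), sub_apply]
      abel
    have h1 : ‖D v ((x₂ - y₂) - (x₁ - y₁))‖ ≤ L * ‖(x₂ - y₂) - (x₁ - y₁)‖ :=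
      (D v).le_of_opNorm_le (hL v) _
    have h2 : ‖v - w‖ ≤ ‖x₂ - x₁‖ + ‖y₂ - y₁‖ := by
      have e : v - w = r • (x₂ - x₁) + (1 - r) • (y₂ - y₁) := by
        rw [hv, hw]
        module
      rw [e]
      refine (norm_add_le _ _).trans ?_
      rw [norm_smul, norm_smul, Real.norm_of_nonneg hr.1,
        Real.norm_of_nonneg (by linarith [hr.2] : 0 ≤ 1 - r)]
      nlinarith [hr.1, hr.2, norm_nonneg (x₂ - x₁), norm_nonneg (y₂ - y₁)]
    have h3 : ‖v - w‖ ^ δ ≤ ‖x₂ - x₁‖ ^ δ + ‖y₂ - y₁‖ ^ δ :=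
      (Real.rpow_le_rpow (norm_nonneg _) h2 hδ0.le).trans
        (Real.rpow_add_le_add_rpow (norm_nonneg _) (norm_nonneg _) hδ0.le hδ1)
    have h4 : ‖(D v - D w) (x₁ - y₁)‖ ≤
        M * ‖x₁ - y₁‖ * (‖x₂ - x₁‖ ^ δ + ‖y₂ - y₁‖ ^ δ) := by
      refine ((D v - D w).le_of_opNorm_le ((hM v w (hball _ _ r hx₂ hy₂ hr)
        (hball _ _ r hx₁ hy₁ hr)).trans (mul_le_mul_of_nonneg_left h3 hM0)) _).trans_eq ?_
      ring
    rw [e]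
    exact (norm_add_le _ _).trans (add_le_add h1 h4)
  rw [sub_sub_sub_comm (g x₂)]
  simpa using norm_image_sub_le_of_norm_deriv_le_segment_01' hder hbound

lemma monoVarLE_comp_sub_comp {g : ℝ → E → G} {D : ℝ → E → E →L[ℝ] G} {x y : ℝ → E}
    {T t0 t1 β r q L N M δ : ℝ} {h : ℝ → ℝ → ℝ}
    (hh : IsControlOn 0 T h) (hβr : 1 ≤ β * r) (hr : 1 ≤ r) (hq : 1 ≤ q) (hqr : q ≤ r * δ)
    (hL : 0 ≤ L) (hM0 : 0 ≤ M) (hδ0 : 0 < δ) (hδ1 : δ ≤ 1)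
    (ht0 : 0 ≤ t0) (ht01 : t0 ≤ t1) (ht1 : t1 ≤ T)
    (hx : FinitePVar q x t0 t1) (hy : FinitePVar q y t0 t1)
    (hxN : ∀ t ∈ Icc t0 t1, ‖x t‖ ≤ N) (hyN : ∀ t ∈ Icc t0 t1, ‖y t‖ ≤ N) (hxy : x t0 = y t0)
    (hD : ∀ t ∈ Icc 0 T, ∀ v, HasFDerivAt (g t) (D t v) v)
    (hgL : ∀ t ∈ Icc 0 T, ∀ v w, ‖g t v - g t w‖ ≤ L * ‖v - w‖)
    (hM : ∀ t ∈ Icc 0 T, ∀ v w, ‖v‖ ≤ N → ‖w‖ ≤ N → ‖D t v - D t w‖ ≤ M * ‖v - w‖ ^ δ)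
    (hDh : ∀ s t, 0 ≤ s → s ≤ t → t ≤ T → ∀ v, ‖D t v - D s v‖ ≤ h s t ^ β) :
    MonoVarLE r (fun s => g s (x s) - g s (y s)) t0 t1
      ((pVar q (fun s => x s - y s) t0 t1 *
        (L + h 0 T ^ β + M * (pVar q x t0 t1 ^ δ + pVar q y t0 t1 ^ δ))) ^ r) := by
  intro n u hu hmem
  have hq0 : 0 < q := by linarith
  have hT : 0 ≤ T := ht0.trans (ht01.trans ht1)
  have hqr' : q ≤ r := hqr.trans (mul_le_of_le_one_right (by linarith) hδ1)
  have hmem' : ∀ i, u i ∈ Icc 0 T := fun i => ⟨ht0.trans (hmem i).1, (hmem i).2.trans ht1⟩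
  have hH0 : 0 ≤ h 0 T ^ β := Real.rpow_nonneg (hh.2.2.2 0 T le_rfl hT le_rfl) _
  have hh0 : ∀ i, 0 ≤ h (u i) (u (i + 1)) ^ β := fun i =>
    Real.rpow_nonneg (hh.2.2.2 _ _ (hmem' i).1 (hu i.le_succ) (hmem' _).2) _
  have hz := FinitePVar.sub hq hx hy
  set z : ℝ → E := fun s => x s - y s with hzdef
  set Z := pVar q z t0 t1 with hZ
  set X := pVar q x t0 t1 with hX
  set Y := pVar q y t0 t1 with hY
  have hZ0 : 0 ≤ Z := pVar_nonneg _ _ _ _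
  have hX0 : 0 ≤ X := pVar_nonneg _ _ _ _
  have hY0 : 0 ≤ Y := pVar_nonneg _ _ _ _
  have hzle : ∀ i, ‖x (u i) - y (u i)‖ ≤ Z := fun i => by
    have h1 : ‖z (u i) - z t0‖ ≤ Z :=
      (hz.monoVarLE hq0).norm_le hq0 le_rfl (hmem i).1 (hmem i).2
    simpa only [hzdef, hxy, sub_self, sub_zero] using h1
  have hstep : ∀ i, ‖g (u (i + 1)) (x (u (i + 1))) - g (u (i + 1)) (y (u (i + 1))) -
      (g (u i) (x (u i)) - g (u i) (y (u i)))‖ ≤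
      (L * ‖z (u (i + 1)) - z (u i)‖ + Z * h (u i) (u (i + 1)) ^ β) +
      (M * Z * ‖x (u (i + 1)) - x (u i)‖ ^ δ + M * Z * ‖y (u (i + 1)) - y (u i)‖ ^ δ) := by
    intro i
    have hDL : ∀ v, ‖D (u (i + 1)) v‖ ≤ L := fun v =>
      (hD _ (hmem' (i + 1)) v).le_of_lip' hL
        (Filter.Eventually.of_forall fun w => hgL _ (hmem' (i + 1)) w v)
    have h1 := norm_four_point_le (hD _ (hmem' (i + 1))) hDL hM0 hδ0 hδ1 (hM _ (hmem' (i + 1)))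
      (hxN _ (hmem i)) (hyN _ (hmem i)) (hxN _ (hmem (i + 1))) (hyN _ (hmem (i + 1)))
    have h2 := Convex.norm_image_sub_le_of_norm_hasFDerivWithin_le
      (f := fun v => g (u (i + 1)) v - g (u i) v)
      (f' := fun v => D (u (i + 1)) v - D (u i) v) (s := univ)
      (fun v _ => ((hD _ (hmem' (i + 1)) v).sub (hD _ (hmem' i) v)).hasFDerivWithinAt)
      (fun v _ => hDh _ _ (hmem' i).1 (hu i.le_succ) (hmem' (i + 1)).2 v)
      convex_univ (mem_univ (y (u i))) (mem_univ (x (u i)))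
    have h3 : M * ‖x (u i) - y (u i)‖ *
        (‖x (u (i + 1)) - x (u i)‖ ^ δ + ‖y (u (i + 1)) - y (u i)‖ ^ δ) ≤
        M * Z * (‖x (u (i + 1)) - x (u i)‖ ^ δ + ‖y (u (i + 1)) - y (u i)‖ ^ δ) :=
      mul_le_mul_of_nonneg_right (mul_le_mul_of_nonneg_left (hzle i) hM0) (by positivity)
    have h4 := mul_le_mul_of_nonneg_left (hzle i) (hh0 i)
    have e : g (u (i + 1)) (x (u (i + 1))) - g (u (i + 1)) (y (u (i + 1))) -
        (g (u i) (x (u i)) - g (u i) (y (u i))) =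
        (g (u (i + 1)) (x (u (i + 1))) - g (u (i + 1)) (y (u (i + 1))) -
          (g (u (i + 1)) (x (u i)) - g (u (i + 1)) (y (u i)))) +
        (g (u (i + 1)) (x (u i)) - g (u i) (x (u i)) -
          (g (u (i + 1)) (y (u i)) - g (u i) (y (u i)))) := by abel
    rw [e]
    refine (norm_add_le _ _).trans ((add_le_add h1 h2).trans ?_)
    simp only [hzdef]
    linarith
  have hpow : ∀ v : ℝ → E, FinitePVar q v t0 t1 →
      ∑ i ∈ Finset.range n, (‖v (u (i + 1)) - v (u i)‖ ^ δ) ^ r ≤ (pVar q v t0 t1 ^ δ) ^ r := by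
    intro v hv
    rw [← Real.rpow_mul (pVar_nonneg _ _ _ _), mul_comm δ]
    refine le_trans (Finset.sum_le_sum fun i _ => ?_)
      (hv.monoVarLE_of_le hq0 hqr n u hu hmem)
    rw [← Real.rpow_mul (norm_nonneg _), mul_comm δ]
  have hMZ : 0 ≤ M * Z := mul_nonneg hM0 hZ0
  have hsum := sum_rpow_le_of_le_add (Finset.range n) hr (fun _ _ => norm_nonneg _)
    (fun i _ => add_nonneg (mul_nonneg hL (norm_nonneg _)) (mul_nonneg hZ0 (hh0 i)))
    (fun i _ => by positivity) (C := L * Z + Z * h 0 T ^ β) (D := M * Z * X ^ δ + M * Z * Y ^ δ)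
    (by positivity) (by positivity) (fun i _ => hstep i)
    (sum_rpow_le_of_le_add _ hr
      (fun i _ => add_nonneg (mul_nonneg hL (norm_nonneg _)) (mul_nonneg hZ0 (hh0 i)))
      (fun _ _ => mul_nonneg hL (norm_nonneg _)) (fun i _ => mul_nonneg hZ0 (hh0 i))
      (by positivity) (by positivity) (fun _ _ => le_rfl)
      (sum_const_mul_rpow_le _ hL hZ0 (fun _ _ => norm_nonneg _)
        (hz.monoVarLE_of_le hq0 hqr' n u hu hmem))
      (sum_const_mul_rpow_le _ hZ0 hH0 (fun i _ => hh0 i) (hh.sum_rpow_le hβr hu hmem' n)))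
    (sum_rpow_le_of_le_add _ hr
      (fun i _ => by positivity) (fun _ _ => by positivity) (fun i _ => by positivity)
      (by positivity) (by positivity) (fun _ _ => le_rfl)
      (sum_const_mul_rpow_le _ hMZ (by positivity) (fun _ _ => by positivity) (hpow x hx))
      (sum_const_mul_rpow_le _ hMZ (by positivity) (fun _ _ => by positivity) (hpow y hy)))
  refine hsum.trans_eq ?_
  congr 1
  ring

end CompositionLemmas


section YoungDifference

variable {E F : Type*} [NormedAddCommGroup E] [NormedSpace ℝ E]
  [NormedAddCommGroup F] [NormedSpace ℝ F]

/-- Increments of the difference of two Young integrals whose integrands agree at the left end. -/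
lemma exists_young_integral_sub_le [ProperSpace F] {k l : ℝ → E →L[ℝ] F} {ω : ℝ → E}
    {a b r p V W C : ℝ} (hab : a ≤ b) (hr : 0 < r) (hp : 1 < p) (hθ : 1 < 1 / p + 1 / r)
    (hkc : ContinuousOn k (Icc a b)) (hlc : ContinuousOn l (Icc a b)) (hk : MonoVarLE r k a b V)
    (hl : MonoVarLE r l a b W) (hω : FinitePVar p ω a b) (hC : 0 ≤ C)
    (hkl : MonoVarLE r (fun z => k z - l z) a b (C ^ r)) (heq : k a = l a) :
    ∃ J : ℝ → F,
      (∀ t ∈ Icc a b, youngIntegral k ω a t - youngIntegral l ω a t = J t - J a) ∧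
      ∀ c d, a ≤ c → c ≤ d → d ≤ b →
        ‖J d - J c‖ ≤ ((1 - (2 : ℝ) ^ (1 - (1 / p + 1 / r)))⁻¹ + 1) * C * pVar p ω c d := by
  have hp0 : 0 < p := by linarith
  have hωV := hω.monoVarLE hp0
  obtain ⟨Jk, hJk, -⟩ := exists_young_integral hab hr hp hθ hkc hk hωV
  obtain ⟨Jl, hJl, -⟩ := exists_young_integral hab hr hp hθ hlc hl hωV
  obtain ⟨J, hJ, hJle⟩ := exists_young_integral hab hr hp hθ (hkc.sub hlc) hkl hωV
  have hCr : (C ^ r) ^ (1 / r) = C := by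
    rw [← Real.rpow_mul hC, mul_one_div_cancel hr.ne', Real.rpow_one]
  refine ⟨J, fun t ht => ?_, fun c d hc hcd hd => ?_⟩
  · have h1 := hJk a t le_rfl ht.1 ht.2
    have h2 := hJl a t le_rfl ht.1 ht.2
    rw [h1.youngIntegral_eq ht.1, h2.youngIntegral_eq ht.1]
    exact (h1.sub h2).unique ht.1 (hJ a t le_rfl ht.1 ht.2)
  · have h1 := hJle c d hc hcd hd
    have h2 : ‖k c - l c‖ ≤ C := by
      have := hkl.norm_le hr le_rfl hc (hcd.trans hd)
      rwa [hCr, heq, sub_self, sub_zero] at this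
    have h3 := (k c - l c).le_of_opNorm_le_of_le h2 (hω.norm_sub_le_pVar hp0 hc hcd hd)
    have h4 := norm_le_norm_sub_add (J d - J c) ((k c - l c) (ω d - ω c))
    rw [hCr, Pi.sub_apply] at h1
    linarith

end YoungDifference

lemma increment_bound_le {l c g h m M K X Y Z t W : ℝ} (hl : l ≤ M) (hm : m ≤ M) (hg : g ≤ M)
    (hh : h ≤ M) (hM : 0 ≤ M) (hK : 0 ≤ K) (hX : 0 ≤ X) (hY : 0 ≤ Y) (hZ : 0 ≤ Z) (ht : 0 ≤ t)
    (hW : 0 ≤ W) (hc : c = Z * (g + h + m * (X + Y))) :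
    l * Z * t + (K + 1) * c * W ≤ Z * (t + W) * (M * (K + 1)) * (2 + X + Y) := by
  have h1 : g + h + m * (X + Y) ≤ M * (2 + X + Y) := by
    linarith [mul_le_mul_of_nonneg_right hm (add_nonneg hX hY)]
  have h2 : l ≤ (K + 1) * (M * (2 + X + Y)) := by
    have h3 : M ≤ M * (2 + X + Y) := le_mul_of_one_le_right hM (by linarith)
    have h4 : M * (2 + X + Y) ≤ (K + 1) * (M * (2 + X + Y)) :=
      le_mul_of_one_le_left (hM.trans h3) (by linarith)
    linarith
  have h5 := mul_le_mul_of_nonneg_right h2 (mul_nonneg hZ ht)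
  have h6 := mul_le_mul_of_nonneg_right h1
    (mul_nonneg (mul_nonneg (by linarith : 0 ≤ K + 1) hZ) hW)
  rw [hc]
  linarith

/-- Proposition `EstIJ`(ii): under (H1)–(H3), for `x, y` continuous of
finite `q`-variation on `[t0,t1] ⊆ [0,T]` with sup-norm `≤ N` and `x t0 = y t0`,
`‖F(x)-F(y)‖_{q-var} ≤ ‖x-y‖_{q-var}((t1-t0) + |||ω|||_{p-var}) M'_N (K+1)
  (2 + |||x|||^δ_{q-var} + |||y|||^δ_{q-var})`. -/
theorem stmt10
    {d m : ℕ} (p T : ℝ) (hp1 : 1 < p) (hp2 : p < 2) (hT : 0 < T)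
    (f : ℝ → Ed d → Ed d) (g : ℝ → Ed d → (Ed m →L[ℝ] Ed d))
    (hf : ContinuousOn (fun pr : ℝ × Ed d => f pr.1 pr.2) (Set.Icc 0 T ×ˢ Set.univ))
    (hg : ContinuousOn (fun pr : ℝ × Ed d => g pr.1 pr.2) (Set.Icc 0 T ×ˢ Set.univ))
    (Dg : ℝ → Ed d → (Ed d →L[ℝ] Ed m →L[ℝ] Ed d))
    (hDg : ∀ t ∈ Set.Icc (0:ℝ) T, ∀ x : Ed d, HasFDerivAt (g t) (Dg t x) x)
    (β δ Lg : ℝ) (hβ0 : 0 < β) (hβ1 : β ≤ 1) (hδ0 : 0 < δ) (hδ1 : δ ≤ 1) (hLg : 0 < Lg)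
    (h : ℝ → ℝ → ℝ) (hctrl : IsControlOn 0 T h)
    (MN : ℝ → ℝ) (hMN : ∀ N : ℝ, 0 ≤ N → 0 < MN N)
    (H1i : ∀ t ∈ Set.Icc (0:ℝ) T, ∀ x y : Ed d, ‖g t x - g t y‖ ≤ Lg * ‖x - y‖)
    (H1ii : ∀ N : ℝ, 0 ≤ N → ∀ t ∈ Set.Icc (0:ℝ) T, ∀ x y : Ed d, ‖x‖ ≤ N → ‖y‖ ≤ N →
      ‖Dg t x - Dg t y‖ ≤ MN N * ‖x - y‖ ^ δ)
    (H1iii : ∀ s t : ℝ, 0 ≤ s → s < t → t ≤ T → ∀ x : Ed d,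
      ‖g t x - g s x‖ + ‖Dg t x - Dg s x‖ ≤ h s t ^ β)
    (a α : ℝ) (b : ℝ → ℝ) (ha : 0 < a) (hα1 : 1 / 2 ≤ α) (hα2 : α < 1)
    (hbmem : IntervalIntegrable (fun s => |b s| ^ (1 / (1 - α))) MeasureTheory.volume 0 T)
    (LN : ℝ → ℝ) (hLN : ∀ N : ℝ, 0 ≤ N → 0 < LN N)
    (H2i : ∀ N : ℝ, 0 ≤ N → ∀ t ∈ Set.Icc (0:ℝ) T, ∀ x y : Ed d, ‖x‖ ≤ N → ‖y‖ ≤ N →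
      ‖f t x - f t y‖ ≤ LN N * ‖x - y‖)
    (H2ii : ∀ t ∈ Set.Icc (0:ℝ) T, ∀ x : Ed d, ‖f t x‖ ≤ a * ‖x‖ + b t)
    (H3a : p - 1 < δ) (H3b : 1 - 1 / p < β) (H3c : 1 - 1 / p < δ * α)
    (q0 q : ℝ)
    (hq0a : 1 - 1 / p < 1 / q0)
    (hq0b : 1 / q0 < min (min β (δ * α)) (min (δ / p) (1 / 2)))
    (hqa : 1 / (q0 * δ) ≤ 1 / q) (hqb : 1 / q < min α (1 / p))
    (ω : ℝ → Ed m) (hω : ContinuousOn ω (Set.Icc 0 T)) (hωp : FinitePVar p ω 0 T)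
    (t0 t1 : ℝ) (ht0 : 0 ≤ t0) (ht01 : t0 ≤ t1) (ht1 : t1 ≤ T)
    (N : ℝ) (hN : 0 ≤ N)
    (x y : ℝ → Ed d)
    (hx : ContinuousOn x (Set.Icc t0 t1)) (hxq : FinitePVar q x t0 t1)
    (hy : ContinuousOn y (Set.Icc t0 t1)) (hyq : FinitePVar q y t0 t1)
    (hxN : ∀ t ∈ Set.Icc t0 t1, ‖x t‖ ≤ N) (hyN : ∀ t ∈ Set.Icc t0 t1, ‖y t‖ ≤ N)
    (hxy0 : x t0 = y t0) :
    pVarNorm q (fun t => Fmap f g ω t0 x t - Fmap f g ω t0 y t) t0 t1 ≤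
      pVarNorm q (fun t => x t - y t) t0 t1 * ((t1 - t0) + pVar p ω t0 t1) *
        (max (max (LN N) (MN N)) (max (max Lg (a * T ^ (1 - α))) (max (‖g 0 0‖ + h 0 T ^ β) ((∫ s in (0:ℝ)..T, |b s| ^ (1 / (1 - α))) ^ (1 - α)))) *
          ((1 - (2:ℝ) ^ (1 - (1 / p + 1 / q0)))⁻¹ + 1)) *
        (2 + pVar q x t0 t1 ^ δ + pVar q y t0 t1 ^ δ) := by
  have hp0 : 0 < p := by linarith
  simp only [lt_min_iff] at hq0b
  obtain ⟨⟨hq0β, -⟩, -, hq0half⟩ := hq0b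
  have hq0inv : 0 < 1 / q0 := by
    have : 1 / p < 1 := (div_lt_one hp0).2 hp1
    linarith
  have hq0pos : 0 < q0 := one_div_pos.1 hq0inv
  have hq0one : 1 ≤ q0 := by
    have := (one_div_lt_one_div hq0pos (by norm_num : (0 : ℝ) < 2)).1 hq0half
    linarith
  have hβq0 : 1 ≤ β * q0 := ((div_lt_iff₀ hq0pos).1 hq0β).le
  have hθ : 1 < 1 / p + 1 / q0 := by linarith
  have hq0δ : 0 < q0 * δ := mul_pos hq0pos hδ0
  have hqpos : 0 < q := one_div_pos.1 ((one_div_pos.2 hq0δ).trans_le hqa)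
  have hqq0 : q ≤ q0 * δ := (one_div_le_one_div hq0δ hqpos).1 hqa
  have hpq : p ≤ q := ((one_div_lt_one_div hqpos hp0).1 (hqb.trans_le (min_le_right _ _))).le
  have hq1 : 1 ≤ q := hp1.le.trans hpq
  have hqq0' : q ≤ q0 := hqq0.trans (mul_le_of_le_one_right hq0pos.le hδ1)
  have hsub : ∀ s ∈ Icc t0 t1, s ∈ Icc 0 T := fun s hs => ⟨ht0.trans hs.1, hs.2.trans ht1⟩
  have hH0 : 0 ≤ h 0 T ^ β := Real.rpow_nonneg (hctrl.2.2.2 0 T le_rfl hT.le le_rfl) _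
  have hgh : ∀ s t, 0 ≤ s → s ≤ t → t ≤ T → ∀ v, ‖g t v - g s v‖ ≤ h s t ^ β :=
    fun s t hs hst ht v => hctrl.norm_sub_le_of_lt (φ := fun r => g r v)
      (fun s t hs hst ht => (le_add_of_nonneg_right (norm_nonneg (Dg t v - Dg s v))).trans
        (H1iii s t hs hst ht v)) hs hst ht
  have hDh : ∀ s t, 0 ≤ s → s ≤ t → t ≤ T → ∀ v, ‖Dg t v - Dg s v‖ ≤ h s t ^ β :=
    fun s t hs hst ht v => hctrl.norm_sub_le_of_lt (φ := fun r => Dg r v)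
      (fun s t hs hst ht => (le_add_of_nonneg_left (norm_nonneg _)).trans
        (H1iii s t hs hst ht v)) hs hst ht
  have hω' : FinitePVar p ω t0 t1 := hωp.mono hp0 ht0 ht1
  have hcomp : ∀ {G : Type} [TopologicalSpace G] {φ : ℝ → Ed d → G} {v : ℝ → Ed d},
      ContinuousOn (fun pr : ℝ × Ed d => φ pr.1 pr.2) (Icc 0 T ×ˢ univ) →
      ContinuousOn v (Icc t0 t1) → ContinuousOn (fun s => φ s (v s)) (Icc t0 t1) :=
    fun hφ hv => hφ.comp (continuousOn_id.prodMk hv) fun s hs => ⟨hsub s hs, mem_univ _⟩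
  set X := pVar q x t0 t1 with hX
  set Y := pVar q y t0 t1 with hY
  set Z := pVar q (fun s => x s - y s) t0 t1 with hZ
  set Ω := pVar p ω t0 t1 with hΩ
  have hX0 : 0 ≤ X ^ δ := Real.rpow_nonneg (pVar_nonneg _ _ _ _) _
  have hY0 : 0 ≤ Y ^ δ := Real.rpow_nonneg (pVar_nonneg _ _ _ _) _
  have hZ0 : 0 ≤ Z := pVar_nonneg _ _ _ _
  have hΩ0 : 0 ≤ Ω := pVar_nonneg _ _ _ _
  have hMN0 := hMN N hN
  have hLN0 := hLN N hN
  set C := Z * (Lg + h 0 T ^ β + MN N * (X ^ δ + Y ^ δ)) with hC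
  have hC0 : 0 ≤ C := by positivity
  have hvar : ∀ v : ℝ → Ed d, FinitePVar q v t0 t1 → MonoVarLE q0 (fun s => g s (v s)) t0 t1 _ :=
    fun v hv => monoVarLE_comp hctrl hβq0 hq0one hqpos hqq0' hLg.le ht0 ht01 ht1 hv H1i hgh
  obtain ⟨J, hJ, hJle⟩ := exists_young_integral_sub_le ht01 hq0pos hp1 hθ (hcomp hg hx)
    (hcomp hg hy) (hvar x hxq) (hvar y hyq) hω' hC0
    (monoVarLE_comp_sub_comp hctrl hβq0 hq0one hq1 hqq0 hLg.le hMN0.le hδ0 hδ1 ht0 ht01 ht1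
      hxq hyq hxN hyN hxy0 hDg H1i (H1ii N hN) hDh) (by simp only [hxy0])
  set K := (1 - (2 : ℝ) ^ (1 - (1 / p + 1 / q0)))⁻¹ with hK
  have hK0 : 0 < K := inv_one_sub_two_rpow_pos hθ
  have hfint : ∀ {v : ℝ → Ed d} {c e : ℝ}, ContinuousOn v (Icc t0 t1) → t0 ≤ c → c ≤ e → e ≤ t1 →
      IntervalIntegrable (fun s => f s (v s)) MeasureTheory.volume c e :=
    fun hv hc hce he => ((hcomp hf hv).mono (by
      rw [uIcc_of_le hce]
      exact Icc_subset_Icc hc he)).intervalIntegrable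
  have hF : ∀ t ∈ Icc t0 t1, Fmap f g ω t0 x t - Fmap f g ω t0 y t =
      (∫ s in t0..t, (f s (x s) - f s (y s))) + (J t - J t0) := by
    intro t ht
    rw [← hJ t ht, intervalIntegral.integral_sub (hfint hx le_rfl ht.1 ht.2)
      (hfint hy le_rfl ht.1 ht.2)]
    simp only [Fmap, hxy0]
    abel
  have hxyZ : ∀ s ∈ Icc t0 t1, ‖x s - y s‖ ≤ Z := fun s hs => by
    have h1 : ‖x s - y s - (x t0 - y t0)‖ ≤ Z :=
      ((FinitePVar.sub hq1 hxq hyq).monoVarLE hqpos).norm_le hqpos le_rfl hs.1 hs.2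
    simpa only [hxy0, sub_self, sub_zero] using h1
  have hinc : ∀ c e, t0 ≤ c → c ≤ e → e ≤ t1 →
      ‖(Fmap f g ω t0 x e - Fmap f g ω t0 y e) - (Fmap f g ω t0 x c - Fmap f g ω t0 y c)‖ ≤
        LN N * Z * (e - c) + (K + 1) * C * pVar p ω c e := by
    intro c e hc hce he
    have hi : ∀ {c e}, t0 ≤ c → c ≤ e → e ≤ t1 →
        IntervalIntegrable (fun s => f s (x s) - f s (y s)) MeasureTheory.volume c e :=
      fun hc hce he => (hfint hx hc hce he).sub (hfint hy hc hce he)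
    have h1 : ‖∫ s in c..e, (f s (x s) - f s (y s))‖ ≤ LN N * Z * |e - c| := by
      refine intervalIntegral.norm_integral_le_of_norm_le_const fun s hs => ?_
      rw [uIoc_of_le hce] at hs
      have hs' : s ∈ Icc t0 t1 := ⟨hc.trans hs.1.le, hs.2.trans he⟩
      exact (H2i N hN s (hsub s hs') _ _ (hxN s hs') (hyN s hs')).trans
        (mul_le_mul_of_nonneg_left (hxyZ s hs') hLN0.le)
    rw [abs_of_nonneg (sub_nonneg.2 hce)] at h1
    rw [hF e ⟨hc.trans hce, he⟩, hF c ⟨hc, hce.trans he⟩, add_sub_add_comm,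
      sub_sub_sub_cancel_right, intervalIntegral.integral_interval_sub_left
        (hi le_rfl (hc.trans hce) he) (hi le_rfl hc (hce.trans he))]
    exact (norm_add_le _ _).trans (add_le_add h1 (hJle c e hc hce he))
  have hmain := pVar_le_of_norm_sub_le (z := fun t => Fmap f g ω t0 x t - Fmap f g ω t0 y t)
    ht01 hp0 hpq hq1 (by positivity) (by positivity) hω' hinc
  have hF0 : Fmap f g ω t0 x t0 - Fmap f g ω t0 y t0 = 0 := by
    simp [hF t0 ⟨le_rfl, ht01⟩]
  simp only [pVarNorm, hF0, hxy0, sub_self, norm_zero, zero_add]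
  refine hmain.trans ?_
  set M' := max (max (LN N) (MN N)) (max (max Lg (a * T ^ (1 - α)))
    (max (‖g 0 0‖ + h 0 T ^ β) ((∫ s in (0:ℝ)..T, |b s| ^ (1 / (1 - α))) ^ (1 - α)))) with hM'
  have hM1 : LN N ≤ M' := (le_max_left _ _).trans (le_max_left _ _)
  have hM2 : MN N ≤ M' := (le_max_right _ _).trans (le_max_left _ _)
  have hM3 : Lg ≤ M' := (le_max_left _ _).trans ((le_max_left _ _).trans (le_max_right _ _))
  have hM4 : h 0 T ^ β ≤ M' := (le_add_of_nonneg_left (norm_nonneg (g 0 0))).trans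
    ((le_max_left _ _).trans ((le_max_right _ _).trans (le_max_right _ _)))
  have hM0 : 0 ≤ M' := hLN0.le.trans hM1
  exact increment_bound_le hM1 hM2 hM3 hM4 hM0 hK0.le hX0 hY0 hZ0 (sub_nonneg.2 ht01) hΩ0 hC
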